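/- Let F : ℂ³ → ℂ³ be a dominant polynomial mapping of degree 2 with S_F ≠ ∅. Then S_F is the union of at most three sets, each of which is the zero set of an irreducible polynomial of total degree at most 2. -/

import Mathlib

open Filter Topology

/-- The asymptotic set of a mapping `F : ℂⁿ → ℂⁿ`. -/
def asymptoticSet {n : ℕ} (F : (Fin n → ℂ) → (Fin n → ℂ)) : Set (Fin n → ℂ) :=
  {a | ∃ ξ : ℕ → (Fin n → ℂ),
    Tendsto (fun k => ‖ξ k‖) atTop atTop ∧ Tendsto (fun k => F (ξ k)) atTop (nhds a)}

/-- A plane in `ℂ³`: the zero set of a polynomial of total degree 1. -/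
def IsPlane (S : Set (Fin 3 → ℂ)) : Prop :=
  ∃ Q : MvPolynomial (Fin 3) ℂ, Q.totalDegree = 1 ∧
    S = {x | MvPolynomial.eval x Q = 0}

/-- A paraboloid in `ℂ³`: the zero set of a polynomial of the form
`r·x_i² + s·x_j + t·x_l + u` where `{i, j, l} = {1, 2, 3}`, `r ≠ 0` and `(s, t) ≠ (0, 0)`. -/
def IsParaboloid (S : Set (Fin 3 → ℂ)) : Prop :=
  ∃ (i j l : Fin 3) (r s t u : ℂ),
    i ≠ j ∧ j ≠ l ∧ i ≠ l ∧ r ≠ 0 ∧ (s, t) ≠ (0, 0) ∧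
    S = {x | r * (x i) ^ 2 + s * x j + t * x l + u = 0}

/-- `F : ℂ³ → ℂ³` is a polynomial mapping of degree 2 with coordinate polynomials `P`. -/
def IsDegTwoPolyMap (P : Fin 3 → MvPolynomial (Fin 3) ℂ)
    (F : (Fin 3 → ℂ) → (Fin 3 → ℂ)) : Prop :=
  (∀ x i, F x i = MvPolynomial.eval x (P i)) ∧
  (∀ i, (P i).totalDegree ≤ 2) ∧ (∃ i, (P i).totalDegree = 2)

/-- The zero set of an irreducible polynomial of total degree at most two in three variables. -/
def IsIrredZeroSet (Z : Set (Fin 3 → ℂ)) : Prop :=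
  ∃ Q : MvPolynomial (Fin 3) ℂ,
    Irreducible Q ∧ Q.totalDegree ≤ 2 ∧ Z = {x | MvPolynomial.eval x Q = 0}

/-- A union of at most three zero sets of irreducible polynomials of degree at most two. -/
def IsUnionOfThree (S : Set (Fin 3 → ℂ)) : Prop :=
  ∃ Z₁ Z₂ Z₃ : Set (Fin 3 → ℂ), (Z₁ = ∅ ∨ IsIrredZeroSet Z₁) ∧ (Z₂ = ∅ ∨ IsIrredZeroSet Z₂) ∧
    (Z₃ = ∅ ∨ IsIrredZeroSet Z₃) ∧ S = Z₁ ∪ Z₂ ∪ Z₃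

section ZeroSets

open MvPolynomial

theorem isIrredZeroSet_graph {i : Fin 3} {c : ℂ} (hc : c ≠ 0) {g : MvPolynomial (Fin 3) ℂ}
    (hg : i ∉ g.vars) (hdeg : g.totalDegree ≤ 2) :
    IsIrredZeroSet {p | c * p i + eval p g = 0} := by
  refine ⟨C c * X i + g, irreducible_mul_X_add _ _ i (by simpa using hc) (by simp) hg ?_, ?_, ?_⟩
  · exact IsUnit.isRelPrime_left ((isUnit_iff_ne_zero.mpr hc).map C)
  · refine (totalDegree_add _ _).trans (max_le ((totalDegree_mul _ _).trans ?_) hdeg)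
    simp
  · ext p; simp

theorem notMem_vars_add {i : Fin 3} {p q : MvPolynomial (Fin 3) ℂ} (hp : i ∉ p.vars)
    (hq : i ∉ q.vars) : i ∉ (p + q).vars := fun h =>
  (Finset.mem_union.mp (vars_add_subset _ _ h)).elim hp hq

theorem notMem_vars_mul {i : Fin 3} {p q : MvPolynomial (Fin 3) ℂ} (hp : i ∉ p.vars)
    (hq : i ∉ q.vars) : i ∉ (p * q).vars := fun h =>
  (Finset.mem_union.mp (vars_mul _ _ h)).elim hp hq

theorem totalDegree_affine_le (a b d : ℂ) (i j : Fin 3) :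
    (C a * X i + C b * X j + C d : MvPolynomial (Fin 3) ℂ).totalDegree ≤ 1 := by
  refine (totalDegree_add _ _).trans (max_le ((totalDegree_add _ _).trans (max_le ?_ ?_)) ?_)
  · exact (totalDegree_mul _ _).trans (by simp)
  · exact (totalDegree_mul _ _).trans (by simp)
  · simp

theorem isIrredZeroSet_plane_aux {a b c d : ℂ} {i j k : Fin 3} (hij : i ≠ j) (hik : i ≠ k)
    (ha : a ≠ 0) : IsIrredZeroSet {p | a * p i + b * p j + c * p k + d = 0} := by
  have := isIrredZeroSet_graph (i := i) ha (g := C b * X j + C c * X k + C d)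
    (notMem_vars_add (notMem_vars_add (notMem_vars_mul (by simp) (by simpa using hij))
      (notMem_vars_mul (by simp) (by simpa using hik))) (by simp))
    ((totalDegree_affine_le _ _ _ _ _).trans (by norm_num))
  convert this using 3
  simp; ring_nf

theorem isIrredZeroSet_plane {a b c d : ℂ} (h : a ≠ 0 ∨ b ≠ 0 ∨ c ≠ 0) :
    IsIrredZeroSet {p | a * p 0 + b * p 1 + c * p 2 + d = 0} := by
  rcases h with h | h | h
  · exact isIrredZeroSet_plane_aux (by decide) (by decide) h
  · convert isIrredZeroSet_plane_aux (i := 1) (j := 0) (k := 2) (b := a) (c := c) (d := d)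
      (by decide) (by decide) h using 3
    ring_nf
  · convert isIrredZeroSet_plane_aux (i := 2) (j := 0) (k := 1) (b := a) (c := b) (d := d)
      (by decide) (by decide) h using 3
    ring_nf

theorem isIrredZeroSet_parabola {D : ℂ} (hD : D ≠ 0) (r s : ℂ) :
    IsIrredZeroSet {p | (p 1 - r) ^ 2 = D * (p 2 - s)} := by
  have := isIrredZeroSet_graph (i := 2) (c := -D) (by simpa using hD)
    (g := (C 1 * X 1 + C 0 * X 0 + C (-r)) * (C 1 * X 1 + C 0 * X 0 + C (-r)) + C (D * s)) ?_ ?_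
  · convert this using 3
    simp only [map_add, map_mul, eval_C, eval_X]
    rw [← sub_eq_zero]; ring_nf
  · have : (2 : Fin 3) ∉ (C 1 * X 1 + C 0 * X 0 + C (-r) : MvPolynomial (Fin 3) ℂ).vars :=
      notMem_vars_add (notMem_vars_add (notMem_vars_mul (by simp) (by simp))
        (notMem_vars_mul (by simp) (by simp))) (by simp)
    exact notMem_vars_add (notMem_vars_mul this this) (by rw [vars_C]; simp)
  · refine (totalDegree_add _ _).trans (max_le ((totalDegree_mul _ _).trans ?_)
      (by rw [totalDegree_C]; norm_num))
    have := totalDegree_affine_le 1 0 (-r) 1 0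
    omega

/-- The linear substitution of variables given by a matrix. -/
noncomputable def linSubst (M : Matrix (Fin 3) (Fin 3) ℂ) :
    MvPolynomial (Fin 3) ℂ →ₐ[ℂ] MvPolynomial (Fin 3) ℂ :=
  aeval fun i => ∑ j, C (M i j) * X j

theorem linSubst_comp (M N : Matrix (Fin 3) (Fin 3) ℂ) (h : M * N = 1) :
    (linSubst N).comp (linSubst M) = AlgHom.id ℂ _ := by
  refine MvPolynomial.algHom_ext fun i => ?_
  have h' : ∀ k, ∑ j, M i j * N j k = (1 : Matrix (Fin 3) (Fin 3) ℂ) i k := fun k => by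
    rw [← h, Matrix.mul_apply]
  have e : ∀ c : ℂ, (linSubst N) (C c) = C c := fun c => (linSubst N).commutes c
  have : ((linSubst N).comp (linSubst M)) (X i) = ∑ k, C (∑ j, M i j * N j k) * X k := by
    simp only [AlgHom.comp_apply]
    conv_lhs => rw [linSubst.eq_def M, aeval_X, map_sum]
    simp only [map_mul, e, map_sum, Finset.sum_mul]
    rw [Finset.sum_comm]
    refine Finset.sum_congr rfl fun j _ => ?_
    rw [linSubst, aeval_X, Finset.mul_sum]
    simp only [mul_assoc]
  rw [this]
  simp [h', Matrix.one_apply]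

theorem eval_linSubst (M : Matrix (Fin 3) (Fin 3) ℂ) (Q : MvPolynomial (Fin 3) ℂ)
    (p : Fin 3 → ℂ) : eval p (linSubst M Q) = eval (M.mulVec p) Q := by
  rw [linSubst, aeval_def, eval_eval₂, eval]
  congr 1
  · ext; simp
  · ext i; simp [Matrix.mulVec, dotProduct]

theorem totalDegree_linSubst_le (M : Matrix (Fin 3) (Fin 3) ℂ) (Q : MvPolynomial (Fin 3) ℂ) :
    (linSubst M Q).totalDegree ≤ Q.totalDegree := by
  rw [linSubst, aeval_def, eval₂_eq']
  refine (totalDegree_finsetSum _ _).trans (Finset.sup_le fun d hd => ?_)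
  refine (totalDegree_mul _ _).trans ?_
  refine le_trans ?_ (le_totalDegree hd)
  have h1 : ∀ i, (∑ j, C (M i j) * X j : MvPolynomial (Fin 3) ℂ).totalDegree ≤ 1 := fun i =>
    (totalDegree_finsetSum _ _).trans
      (Finset.sup_le fun j _ => (totalDegree_mul _ _).trans (by simp))
  have h2 : (∏ i, (∑ j, C (M i j) * X j : MvPolynomial (Fin 3) ℂ) ^ d i).totalDegree
      ≤ ∑ i, d i := by
    refine (totalDegree_finsetProd _ _).trans (Finset.sum_le_sum fun i _ => ?_)
    refine (totalDegree_pow _ _).trans ?_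
    nlinarith [h1 i]
  rw [Finsupp.sum_fintype _ _ (by simp)]
  simpa [algebraMap_eq] using h2

theorem IsIrredZeroSet.preimage {Z : Set (Fin 3 → ℂ)} (hZ : IsIrredZeroSet Z)
    {M : Matrix (Fin 3) (Fin 3) ℂ} (hM : M.det ≠ 0) :
    IsIrredZeroSet ((fun p => M.mulVec p) ⁻¹' Z) := by
  obtain ⟨Q, hQ, hd, rfl⟩ := hZ
  have hu : IsUnit M.det := isUnit_iff_ne_zero.mpr hM
  let σ : MvPolynomial (Fin 3) ℂ ≃ₐ[ℂ] MvPolynomial (Fin 3) ℂ :=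
    AlgEquiv.ofAlgHom (linSubst M) (linSubst M⁻¹)
      (linSubst_comp _ _ (Matrix.nonsing_inv_mul M hu))
      (linSubst_comp _ _ (Matrix.mul_nonsing_inv M hu))
  refine ⟨linSubst M Q, ?_, (totalDegree_linSubst_le M Q).trans hd, ?_⟩
  · exact (MulEquiv.irreducible_iff σ).mpr hQ
  · ext p; simp [eval_linSubst]

theorem IsUnionOfThree.preimage {S : Set (Fin 3 → ℂ)} (hS : IsUnionOfThree S)
    {M : Matrix (Fin 3) (Fin 3) ℂ} (hM : M.det ≠ 0) :
    IsUnionOfThree ((fun p => M.mulVec p) ⁻¹' S) := by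
  obtain ⟨Z₁, Z₂, Z₃, h1, h2, h3, rfl⟩ := hS
  refine ⟨_, _, _, ?_, ?_, ?_, by rw [Set.preimage_union, Set.preimage_union]⟩
  · exact h1.imp (fun h => by simp [h]) fun h => h.preimage hM
  · exact h2.imp (fun h => by simp [h]) fun h => h.preimage hM
  · exact h3.imp (fun h => by simp [h]) fun h => h.preimage hM

theorem exists_quadratic_eq {a b : ℂ} (h : a ≠ 0 ∨ b ≠ 0) (c : ℂ) :
    ∃ t, a * t ^ 2 + b * t = c := by
  by_cases ha : a = 0
  · have hb : b ≠ 0 := by simpa [ha] using h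
    exact ⟨c / b, by field_simp; simp [ha]⟩
  · obtain ⟨s, hs⟩ := IsAlgClosed.exists_pow_nat_eq (b ^ 2 + 4 * a * c) (n := 2) (by norm_num)
    refine ⟨(s - b) / (2 * a), ?_⟩
    field_simp
    linear_combination hs

/-- A cylinder over a plane curve parametrised by two quadratic polynomials. -/
theorem isIrredZeroSet_curve {h₀ h₁ h₂ k₀ k₁ k₂ : ℂ}
    (hne : (h₁ ≠ 0 ∨ h₂ ≠ 0) ∨ (k₁ ≠ 0 ∨ k₂ ≠ 0)) :
    IsIrredZeroSet {p | ∃ t, p 1 = h₂ * t ^ 2 + h₁ * t + h₀ ∧ p 2 = k₂ * t ^ 2 + k₁ * t + k₀} := by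
  by_cases hD : h₂ * k₁ - h₁ * k₂ = 0
  · rcases hne with hne | hne
    · obtain ⟨κ, hκ1, hκ2⟩ : ∃ κ, k₁ = κ * h₁ ∧ k₂ = κ * h₂ := by
        rcases hne with h | h
        · exact ⟨k₁ / h₁, by field_simp, by field_simp; linear_combination -hD⟩
        · exact ⟨k₂ / h₂, by field_simp; linear_combination hD, by field_simp⟩
      convert isIrredZeroSet_plane (a := 0) (b := -κ) (c := 1) (d := κ * h₀ - k₀)
        (by simp) using 2
      ext p
      constructor
      · rintro ⟨t, h1, h2⟩
        rw [h1, h2, hκ1, hκ2]; ring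
      · intro h
        obtain ⟨t, ht⟩ := exists_quadratic_eq (a := h₂) (b := h₁) hne.symm (p 1 - h₀)
        exact ⟨t, by linear_combination -ht, by
          rw [hκ1, hκ2]; linear_combination h - κ * ht⟩
    · obtain ⟨κ, hκ1, hκ2⟩ : ∃ κ, h₁ = κ * k₁ ∧ h₂ = κ * k₂ := by
        rcases hne with h | h
        · exact ⟨h₁ / k₁, by field_simp, by field_simp; linear_combination hD⟩
        · exact ⟨h₂ / k₂, by field_simp; linear_combination -hD, by field_simp⟩
      convert isIrredZeroSet_plane (a := 0) (b := 1) (c := -κ) (d := κ * k₀ - h₀)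
        (by simp) using 2
      ext p
      constructor
      · rintro ⟨t, h1, h2⟩
        rw [h1, h2, hκ1, hκ2]; ring
      · intro h
        obtain ⟨t, ht⟩ := exists_quadratic_eq (a := k₂) (b := k₁) hne.symm (p 2 - k₀)
        exact ⟨t, by rw [hκ1, hκ2]; linear_combination h - κ * ht, by linear_combination -ht⟩
  · set D := h₂ * k₁ - h₁ * k₂ with hDdef
    have := (isIrredZeroSet_parabola hD (h₂ * k₀ - k₂ * h₀) (k₁ * h₀ - h₁ * k₀)).preimage
      (M := !![1, 0, 0; 0, -k₂, h₂; 0, k₁, -h₁]) (by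
        rw [Matrix.det_fin_three]; simp
        intro h; apply hD; rw [hDdef]; linear_combination -h)
    convert this using 1
    ext p
    simp only [Set.mem_ofPred_eq, Set.mem_preimage, Matrix.mulVec, dotProduct, Fin.sum_univ_three]
    simp
    constructor
    · rintro ⟨t, h1, h2⟩
      rw [h1, h2, hDdef]; ring
    · intro h
      refine ⟨(h₂ * (p 2 - k₀) - k₂ * (p 1 - h₀)) / D, ?_, ?_⟩
      · field_simp
        rw [hDdef] at h ⊢
        linear_combination -h₂ * h
      · field_simp
        rw [hDdef] at h ⊢
        linear_combination -k₂ * h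

theorem IsIrredZeroSet.not_dense {Z : Set (Fin 3 → ℂ)} (hZ : IsIrredZeroSet Z) : ¬ Dense Z := by
  obtain ⟨Q, hQ, -, rfl⟩ := hZ
  intro hd
  have hc : IsClosed {x | eval x Q = 0} :=
    isClosed_eq (MvPolynomial.continuous_eval Q) continuous_const
  have hu : {x | eval x Q = 0} = Set.univ := by rw [← hc.closure_eq]; exact hd.closure_eq
  apply hQ.ne_zero
  refine MvPolynomial.funext fun x => ?_
  have : x ∈ {x | eval x Q = 0} := by rw [hu]; trivial
  simpa using this

theorem not_dense_range_of_two_variables (P : Fin 3 → MvPolynomial (Fin 2) ℂ)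
    (F : (Fin 3 → ℂ) → (Fin 3 → ℂ)) (a : (Fin 3 → ℂ) → Fin 2 → ℂ)
    (hF : ∀ p i, F p i = eval (a p) (P i)) : ¬ Dense (Set.range F) := by
  intro hd
  have hdep : ¬ AlgebraicIndependent ℂ P := by
    intro h
    have := h.cardinalMk_le_trdeg
    rw [MvPolynomial.trdeg_of_isDomain] at this
    simp at this
    norm_cast at this
  rw [algebraicIndependent_iff] at hdep
  push Not at hdep
  obtain ⟨Q, hQ, hQ0⟩ := hdep
  apply hQ0
  have hc : IsClosed {x | eval x Q = 0} :=
    isClosed_eq (MvPolynomial.continuous_eval Q) continuous_const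
  have hsub : Set.range F ⊆ {x | eval x Q = 0} := by
    rintro _ ⟨p, rfl⟩
    have h2 : F p = fun i => eval (a p) (P i) := funext (hF p)
    have h3 := congrArg (eval (a p)) hQ
    rw [aeval_def, eval_eval₂, map_zero] at h3
    rw [Set.mem_ofPred_eq, h2, eval, ← h3]
    change eval₂ _ _ Q = _
    congr 1
    ext
    simp
  refine MvPolynomial.funext fun x => ?_
  have := hc.closure_subset_iff.mpr hsub (hd x)
  simpa using this

end ZeroSets

section Asymptotics

open Bornology

theorem mem_asymptoticSet_of_tendsto {ι : Type*} {l : Filter ι} [l.NeBot] [l.IsCountablyGenerated]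
    {n : ℕ} {F : (Fin n → ℂ) → (Fin n → ℂ)} {ξ : ι → Fin n → ℂ} {a : Fin n → ℂ}
    (hξ : Tendsto (fun k => ‖ξ k‖) l atTop) (hF : Tendsto (fun k => F (ξ k)) l (𝓝 a)) :
    a ∈ asymptoticSet F := by
  obtain ⟨s, hs⟩ := exists_seq_tendsto l
  exact ⟨fun k => ξ (s k), hξ.comp hs, hF.comp hs⟩

theorem tendsto_nhds_or_cobounded {ι : Type*} (U : Ultrafilter ι) (f : ι → ℂ) :
    (∃ c, Tendsto f U (𝓝 c)) ∨ Tendsto f U (cobounded ℂ) := by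
  by_cases h : Tendsto f U (cobounded ℂ)
  · exact Or.inr h
  · left
    rw [Filter.tendsto_def] at h
    push Not at h
    obtain ⟨s, hs, hsU⟩ := h
    have hb : IsBounded sᶜ := by rwa [← isCobounded_compl_iff, compl_compl]
    have hmem : sᶜ ∈ U.map f := by
      rw [Ultrafilter.mem_map, Set.preimage_compl]
      exact Ultrafilter.compl_mem_iff_notMem.mpr hsU
    obtain ⟨c, -, hc⟩ := hb.isCompact_closure.ultrafilter_le_nhds (U.map f)
      (le_principal_iff.mpr (mem_of_superset hmem subset_closure))
    exact ⟨c, hc⟩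

/-- The mapping of `ℂ³` with the given coordinate functions. -/
def mkMap (f g h : ℂ → ℂ → ℂ → ℂ) : (Fin 3 → ℂ) → (Fin 3 → ℂ) :=
  fun p => ![f (p 0) (p 1) (p 2), g (p 0) (p 1) (p 2), h (p 0) (p 1) (p 2)]

theorem exists_ultrafilter_of_mem_asymptoticSet {f g h : ℂ → ℂ → ℂ → ℂ} {p : Fin 3 → ℂ}
    (hp : p ∈ asymptoticSet (mkMap f g h)) :
    ∃ (U : Ultrafilter ℕ) (x y z : ℕ → ℂ),
      (∀ x₀ y₀ z₀, Tendsto x U (𝓝 x₀) → Tendsto y U (𝓝 y₀) → ¬ Tendsto z U (𝓝 z₀)) ∧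
      Tendsto (fun n => f (x n) (y n) (z n)) U (𝓝 (p 0)) ∧
      Tendsto (fun n => g (x n) (y n) (z n)) U (𝓝 (p 1)) ∧
      Tendsto (fun n => h (x n) (y n) (z n)) U (𝓝 (p 2)) := by
  obtain ⟨ξ, hξ, hF⟩ := hp
  refine ⟨Ultrafilter.of atTop, fun n => ξ n 0, fun n => ξ n 1, fun n => ξ n 2, ?_, ?_⟩
  · intro x₀ y₀ z₀ hx hy hz
    have hlim : Tendsto ξ (Ultrafilter.of atTop : Ultrafilter ℕ) (𝓝 ![x₀, y₀, z₀]) := by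
      rw [tendsto_pi_nhds]
      intro i
      fin_cases i
      · exact hx
      · exact hy
      · exact hz
    exact not_tendsto_nhds_of_tendsto_atTop (hξ.mono_left (Ultrafilter.of_le _)) _ hlim.norm
  · have hF' := tendsto_pi_nhds.mp (hF.mono_left (Ultrafilter.of_le atTop))
    exact ⟨hF' 0, hF' 1, hF' 2⟩

theorem tendsto_norm_of_coord {ι : Type*} {l : Filter ι} {ξ : ι → Fin 3 → ℂ} (i : Fin 3)
    (h : Tendsto (fun k => ξ k i) l (cobounded ℂ)) : Tendsto (fun k => ‖ξ k‖) l atTop :=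
  tendsto_atTop_mono (fun k => norm_le_pi_norm (ξ k) i) (tendsto_norm_atTop_iff_cobounded.mpr h)

theorem mem_asymptoticSet_of_path {f g h : ℂ → ℂ → ℂ → ℂ} {x y z a b c : ℂ → ℂ} {p : Fin 3 → ℂ}
    (hinf : Tendsto x (𝓝[≠] 0) (cobounded ℂ) ∨ Tendsto y (𝓝[≠] 0) (cobounded ℂ) ∨
      Tendsto z (𝓝[≠] 0) (cobounded ℂ))
    (ha : ContinuousAt a 0) (hb : ContinuousAt b 0) (hc : ContinuousAt c 0)
    (heq : ∀ᶠ t in 𝓝[≠] 0, f (x t) (y t) (z t) = a t ∧ g (x t) (y t) (z t) = b t ∧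
      h (x t) (y t) (z t) = c t)
    (hpa : a 0 = p 0) (hpb : b 0 = p 1) (hpc : c 0 = p 2) :
    p ∈ asymptoticSet (mkMap f g h) := by
  refine mem_asymptoticSet_of_tendsto (l := 𝓝[≠] (0 : ℂ)) (ξ := fun t => ![x t, y t, z t]) ?_ ?_
  · rcases hinf with H | H | H
    · exact tendsto_norm_of_coord 0 H
    · exact tendsto_norm_of_coord 1 H
    · exact tendsto_norm_of_coord 2 H
  · rw [tendsto_pi_nhds]
    intro i
    fin_cases i
    · refine ((hpa ▸ ha.tendsto).mono_left nhdsWithin_le_nhds).congr' ?_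
      filter_upwards [heq] with t ht using ht.1.symm
    · refine ((hpb ▸ hb.tendsto).mono_left nhdsWithin_le_nhds).congr' ?_
      filter_upwards [heq] with t ht using ht.2.1.symm
    · refine ((hpc ▸ hc.tendsto).mono_left nhdsWithin_le_nhds).congr' ?_
      filter_upwards [heq] with t ht using ht.2.2.symm

section LeadingCoefficient

variable {ι : Type*} {l : Filter ι} [l.NeBot] {x c₀ c₁ c₂ c₃ c₄ c₅ c₆ : ι → ℂ}
  {γ₀ γ₁ γ₂ γ₃ γ₄ γ₅ γ₆ : ℂ}

theorem leadingCoeff_one (hx : Tendsto x l (cobounded ℂ)) (h₀ : Tendsto c₀ l (𝓝 γ₀))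
    (h₁ : Tendsto c₁ l (𝓝 γ₁)) (h : ∀ᶠ n in l, c₁ n * x n + c₀ n = 0) : γ₁ = 0 := by
  have hi : Tendsto (fun n => (x n)⁻¹) l (𝓝 0) := tendsto_inv₀_cobounded.comp hx
  have h2 := h₁.add (h₀.mul hi)
  have h3 : Tendsto (fun n => c₁ n + c₀ n * (x n)⁻¹) l (𝓝 0) := by
    refine tendsto_const_nhds.congr' ?_
    filter_upwards [h, hx.eventually (eventually_ne_cobounded 0)] with n hn hne
    field_simp
    linear_combination -hn
  simpa using tendsto_nhds_unique h2 h3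

theorem leadingCoeff_two (hx : Tendsto x l (cobounded ℂ)) (h₀ : Tendsto c₀ l (𝓝 γ₀))
    (h₁ : Tendsto c₁ l (𝓝 γ₁)) (h₂ : Tendsto c₂ l (𝓝 γ₂))
    (h : ∀ᶠ n in l, c₂ n * x n ^ 2 + c₁ n * x n + c₀ n = 0) : γ₂ = 0 := by
  refine leadingCoeff_one hx (h₁.add (h₀.mul (tendsto_inv₀_cobounded.comp hx))) h₂ ?_
  filter_upwards [h, hx.eventually (eventually_ne_cobounded 0)] with n hn hne
  simp only [Function.comp_apply]
  field_simp
  linear_combination hn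

theorem leadingCoeff_three (hx : Tendsto x l (cobounded ℂ)) (h₀ : Tendsto c₀ l (𝓝 γ₀))
    (h₁ : Tendsto c₁ l (𝓝 γ₁)) (h₂ : Tendsto c₂ l (𝓝 γ₂)) (h₃ : Tendsto c₃ l (𝓝 γ₃))
    (h : ∀ᶠ n in l, c₃ n * x n ^ 3 + c₂ n * x n ^ 2 + c₁ n * x n + c₀ n = 0) : γ₃ = 0 := by
  refine leadingCoeff_two hx (h₁.add (h₀.mul (tendsto_inv₀_cobounded.comp hx))) h₂ h₃ ?_
  filter_upwards [h, hx.eventually (eventually_ne_cobounded 0)] with n hn hne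
  simp only [Function.comp_apply]
  field_simp
  linear_combination hn

theorem leadingCoeff_four (hx : Tendsto x l (cobounded ℂ)) (h₀ : Tendsto c₀ l (𝓝 γ₀))
    (h₁ : Tendsto c₁ l (𝓝 γ₁)) (h₂ : Tendsto c₂ l (𝓝 γ₂)) (h₃ : Tendsto c₃ l (𝓝 γ₃))
    (h₄ : Tendsto c₄ l (𝓝 γ₄)) (h : ∀ᶠ n in l,
      c₄ n * x n ^ 4 + c₃ n * x n ^ 3 + c₂ n * x n ^ 2 + c₁ n * x n + c₀ n = 0) : γ₄ = 0 := by
  refine leadingCoeff_three hx (h₁.add (h₀.mul (tendsto_inv₀_cobounded.comp hx))) h₂ h₃ h₄ ?_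
  filter_upwards [h, hx.eventually (eventually_ne_cobounded 0)] with n hn hne
  simp only [Function.comp_apply]
  field_simp
  linear_combination hn

theorem leadingCoeff_five (hx : Tendsto x l (cobounded ℂ)) (h₀ : Tendsto c₀ l (𝓝 γ₀))
    (h₁ : Tendsto c₁ l (𝓝 γ₁)) (h₂ : Tendsto c₂ l (𝓝 γ₂)) (h₃ : Tendsto c₃ l (𝓝 γ₃))
    (h₄ : Tendsto c₄ l (𝓝 γ₄)) (h₅ : Tendsto c₅ l (𝓝 γ₅)) (h : ∀ᶠ n in l, c₅ n * x n ^ 5 +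
      c₄ n * x n ^ 4 + c₃ n * x n ^ 3 + c₂ n * x n ^ 2 + c₁ n * x n + c₀ n = 0) : γ₅ = 0 := by
  refine leadingCoeff_four hx (h₁.add (h₀.mul (tendsto_inv₀_cobounded.comp hx))) h₂ h₃ h₄ h₅ ?_
  filter_upwards [h, hx.eventually (eventually_ne_cobounded 0)] with n hn hne
  simp only [Function.comp_apply]
  field_simp
  linear_combination hn

theorem leadingCoeff_six (hx : Tendsto x l (cobounded ℂ)) (h₀ : Tendsto c₀ l (𝓝 γ₀))
    (h₁ : Tendsto c₁ l (𝓝 γ₁)) (h₂ : Tendsto c₂ l (𝓝 γ₂)) (h₃ : Tendsto c₃ l (𝓝 γ₃))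
    (h₄ : Tendsto c₄ l (𝓝 γ₄)) (h₅ : Tendsto c₅ l (𝓝 γ₅)) (h₆ : Tendsto c₆ l (𝓝 γ₆))
    (h : ∀ᶠ n in l, c₆ n * x n ^ 6 + c₅ n * x n ^ 5 +
      c₄ n * x n ^ 4 + c₃ n * x n ^ 3 + c₂ n * x n ^ 2 + c₁ n * x n + c₀ n = 0) : γ₆ = 0 := by
  refine leadingCoeff_five hx (h₁.add (h₀.mul (tendsto_inv₀_cobounded.comp hx))) h₂ h₃ h₄ h₅ h₆ ?_
  filter_upwards [h, hx.eventually (eventually_ne_cobounded 0)] with n hn hne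
  simp only [Function.comp_apply]
  field_simp
  linear_combination hn

end LeadingCoefficient

theorem exists_tendsto_of_quadratic {ι : Type*} {U : Ultrafilter ι} {x : ι → ℂ} {h₀ h₁ h₂ w : ℂ}
    (hne : h₁ ≠ 0 ∨ h₂ ≠ 0)
    (hw : Tendsto (fun n => h₂ * x n ^ 2 + h₁ * x n + h₀) U (𝓝 w)) :
    ∃ x₀, Tendsto x U (𝓝 x₀) ∧ w = h₂ * x₀ ^ 2 + h₁ * x₀ + h₀ := by
  rcases tendsto_nhds_or_cobounded U x with ⟨x₀, hx⟩ | hx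
  · exact ⟨x₀, hx, tendsto_nhds_unique hw ((((hx.pow 2).const_mul h₂).add
      (hx.const_mul h₁)).add tendsto_const_nhds)⟩
  · exfalso
    have hc := hw.const_sub h₀
    have e2 : h₂ = 0 := leadingCoeff_two hx hc (tendsto_const_nhds (x := h₁))
      (tendsto_const_nhds (x := h₂)) (Eventually.of_forall fun n => by ring)
    have e1 : h₁ = 0 := leadingCoeff_one hx hc (tendsto_const_nhds (x := h₁))
      (Eventually.of_forall fun n => by rw [e2]; ring)
    simp [e1, e2] at hne

theorem isIrredZeroSet_of_plane {a b c d : ℂ} {Z : Set (Fin 3 → ℂ)} (h : a ≠ 0 ∨ b ≠ 0 ∨ c ≠ 0)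
    (hZ : ∀ p, p ∈ Z ↔ a * p 0 + b * p 1 + c * p 2 + d = 0) : IsIrredZeroSet Z := by
  convert isIrredZeroSet_plane (d := d) h using 1
  ext p; exact hZ p

theorem isIrredZeroSet_horizontal (w : ℂ) : IsIrredZeroSet {p | p 2 = w} :=
  isIrredZeroSet_of_plane (a := 0) (b := 0) (c := 1) (d := -w) (by simp) fun p => by
    rw [Set.mem_ofPred_eq, ← sub_eq_zero]; ring_nf

theorem isIrredZeroSet_curve' {h₀ h₁ h₂ k₀ k₁ k₂ : ℂ} (hne : k₁ ≠ 0 ∨ k₂ ≠ 0) :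
    IsIrredZeroSet {p | ∃ t, p 0 = h₂ * t ^ 2 + h₁ * t + h₀ ∧ p 2 = k₂ * t ^ 2 + k₁ * t + k₀} := by
  convert (isIrredZeroSet_curve (h₀ := h₀) (h₁ := h₁) (h₂ := h₂) (k₀ := k₀) (k₁ := k₁) (k₂ := k₂)
    (Or.inr hne)).preimage (M := !![0, 1, 0; 1, 0, 0; 0, 0, 1])
    (by rw [Matrix.det_fin_three]; simp) using 1
  ext p
  simp [dotProduct, Fin.sum_univ_three]

theorem IsUnionOfThree.of_one {S : Set (Fin 3 → ℂ)} (h : S = ∅ ∨ IsIrredZeroSet S) :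
    IsUnionOfThree S :=
  ⟨S, ∅, ∅, h, Or.inl rfl, Or.inl rfl, by simp⟩

theorem IsUnionOfThree.of_two {S Z₁ Z₂ : Set (Fin 3 → ℂ)} (h₁ : Z₁ = ∅ ∨ IsIrredZeroSet Z₁)
    (h₂ : Z₂ = ∅ ∨ IsIrredZeroSet Z₂) (hS : S = Z₁ ∪ Z₂) : IsUnionOfThree S :=
  ⟨Z₁, Z₂, ∅, h₁, h₂, Or.inl rfl, by simp [hS]⟩

theorem tendsto_inv_punctured : Tendsto (fun t : ℂ => t⁻¹) (𝓝[≠] 0) (cobounded ℂ) :=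
  tendsto_inv₀_nhdsNE_zero

end Asymptotics

section BaseLine

open Bornology

theorem tendsto_two {ι : Type*} {l : Filter ι} {B : ℂ → ℂ → ℂ}
    (hB : Continuous fun v : ℂ × ℂ => B v.1 v.2) {x y : ι → ℂ} {x₀ y₀ : ℂ}
    (hx : Tendsto x l (𝓝 x₀)) (hy : Tendsto y l (𝓝 y₀)) :
    Tendsto (fun n => B (x n) (y n)) l (𝓝 (B x₀ y₀)) :=
  Tendsto.comp (f := fun n => (x n, y n)) (hB.tendsto (x₀, y₀)) (hx.prodMk_nhds hy)

/-- The polynomial of degree two in two variables with the given coefficients. -/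
def quadFn (a : Fin 6 → ℂ) (x y : ℂ) : ℂ :=
  a 0 * x ^ 2 + a 1 * (x * y) + a 2 * y ^ 2 + a 3 * x + a 4 * y + a 5

theorem continuous_quadFn (a : Fin 6 → ℂ) : Continuous fun v : ℂ × ℂ => quadFn a v.1 v.2 := by
  unfold quadFn; fun_prop

/-- The mapping `(x * z + p, y * z + q, B)` with `p`, `q`, `B` depending on `x` and `y` only. -/
def pencilMap (p q : Fin 6 → ℂ) (B : ℂ → ℂ → ℂ) : (Fin 3 → ℂ) → (Fin 3 → ℂ) :=
  mkMap (fun x y z => x * z + quadFn p x y) (fun x y z => y * z + quadFn q x y)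
    (fun x y _ => B x y)

variable {p q : Fin 6 → ℂ} {B : ℂ → ℂ → ℂ}

theorem mem_pencilMap_of_horizontal (hB : Continuous fun v : ℂ × ℂ => B v.1 v.2) {a : Fin 3 → ℂ}
    (ha : a 2 = B 0 0) : a ∈ asymptoticSet (pencilMap p q B) := by
  have hp := continuous_quadFn p
  have hq := continuous_quadFn q
  have hB' : Continuous fun t : ℂ => B ((a 0 - p 5) * t) ((a 1 - q 5) * t) :=
    hB.comp (f := fun t : ℂ => ((a 0 - p 5) * t, (a 1 - q 5) * t)) (by fun_prop)
  refine mem_asymptoticSet_of_path (x := fun t => (a 0 - p 5) * t) (y := fun t => (a 1 - q 5) * t)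
    (z := fun t => t⁻¹)
    (a := fun t => a 0 - p 5 + quadFn p ((a 0 - p 5) * t) ((a 1 - q 5) * t))
    (b := fun t => a 1 - q 5 + quadFn q ((a 0 - p 5) * t) ((a 1 - q 5) * t))
    (c := fun t => B ((a 0 - p 5) * t) ((a 1 - q 5) * t))
    (Or.inr (Or.inr tendsto_inv_punctured)) (by unfold quadFn; fun_prop)
    (by unfold quadFn; fun_prop) hB'.continuousAt ?_ ?_ ?_ ?_
  · filter_upwards [self_mem_nhdsWithin] with t ht
    have ht : t ≠ 0 := ht
    refine ⟨?_, ?_, rfl⟩ <;> field_simp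
  · simp [quadFn]
  · simp [quadFn]
  · simp [ha]

theorem pencilMap_cases (hB : Continuous fun v : ℂ × ℂ => B v.1 v.2) {a : Fin 3 → ℂ}
    (ha : a ∈ asymptoticSet (pencilMap p q B)) :
    a 2 = B 0 0 ∨ ∃ (U : Ultrafilter ℕ) (x y u v : ℕ → ℂ),
      (∀ x₀ y₀, Tendsto x U (𝓝 x₀) → ¬ Tendsto y U (𝓝 y₀)) ∧
      Tendsto u U (𝓝 (a 0)) ∧ Tendsto v U (𝓝 (a 1)) ∧
      Tendsto (fun n => B (x n) (y n)) U (𝓝 (a 2)) ∧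
      ∀ n, y n * quadFn p (x n) (y n) - x n * quadFn q (x n) (y n) + v n * x n - u n * y n = 0 := by
  obtain ⟨U, x, y, z, hU, hu, hv, hw⟩ := exists_ultrafilter_of_mem_asymptoticSet ha
  by_cases hxy : ∃ x₀ y₀, Tendsto x U (𝓝 x₀) ∧ Tendsto y U (𝓝 y₀)
  · left
    obtain ⟨x₀, y₀, hx, hy⟩ := hxy
    have hz : Tendsto z U (cobounded ℂ) :=
      (tendsto_nhds_or_cobounded U z).resolve_left fun ⟨z₀, hz⟩ => hU x₀ y₀ z₀ hx hy hz
    have hpl : Tendsto (fun n => quadFn p (x n) (y n)) U (𝓝 (quadFn p x₀ y₀)) :=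
      tendsto_two (continuous_quadFn p) hx hy
    have hql : Tendsto (fun n => quadFn q (x n) (y n)) U (𝓝 (quadFn q x₀ y₀)) :=
      tendsto_two (continuous_quadFn q) hx hy
    have hBl : Tendsto (fun n => B (x n) (y n)) U (𝓝 (B x₀ y₀)) :=
      tendsto_two hB hx hy
    have hx0 : x₀ = 0 := leadingCoeff_one hz (hpl.sub hu) hx
      (Eventually.of_forall fun n => by ring)
    have hy0 : y₀ = 0 := leadingCoeff_one hz (hql.sub hv) hy
      (Eventually.of_forall fun n => by ring)
    rw [tendsto_nhds_unique hw hBl, hx0, hy0]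
  · right
    refine ⟨U, x, y, fun n => x n * z n + quadFn p (x n) (y n),
      fun n => y n * z n + quadFn q (x n) (y n), fun x₀ y₀ hx hy => hxy ⟨x₀, y₀, hx, hy⟩,
      hu, hv, hw, fun n => ?_⟩
    ring

theorem pencilMap_parallel_subset {h₀ h₁ h₂ : ℂ} (hne : h₁ ≠ 0 ∨ h₂ ≠ 0) {a : Fin 3 → ℂ}
    (ha : a ∈ asymptoticSet (pencilMap p q fun x _ => h₂ * x ^ 2 + h₁ * x + h₀)) :
    a 2 = h₀ ∨ p 2 = 0 ∧ ∃ t, a 2 = h₂ * t ^ 2 + h₁ * t + h₀ ∧ (p 1 - q 2) * t + p 4 = 0 ∧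
      (p 1 - q 2 = 0 → p 4 = 0 → a 0 = (p 0 - q 1) * t ^ 2 + (p 3 - q 4) * t + p 5) := by
  rcases pencilMap_cases (by fun_prop) ha with h | ⟨U, x, y, u, v, hxy, hu, hv, hw, hK⟩
  · left; simpa using h
  right
  obtain ⟨t, hx, ht⟩ := exists_tendsto_of_quadratic hne hw
  have hy : Tendsto y U (cobounded ℂ) :=
    (tendsto_nhds_or_cobounded U y).resolve_left fun ⟨y₀, hy⟩ => hxy t y₀ hx hy
  have hc₀ := ((((hx.pow 3).const_mul (-q 0)).add ((hx.pow 2).const_mul (-q 3))).add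
    (hx.const_mul (-q 5))).add (hv.mul hx)
  have hc₁ := ((((hx.pow 2).const_mul (p 0 - q 1)).add (hx.const_mul (p 3 - q 4))).add_const
    (p 5)).sub hu
  have hc₂ := (hx.const_mul (p 1 - q 2)).add_const (p 4)
  have e3 : p 2 = 0 := leadingCoeff_three hy hc₀ hc₁ hc₂ (tendsto_const_nhds (x := p 2))
    (Eventually.of_forall fun n => by have := hK n; unfold quadFn at this; linear_combination this)
  have e2 := leadingCoeff_two hy hc₀ hc₁ hc₂ (Eventually.of_forall fun n => by
    have := hK n; unfold quadFn at this; linear_combination this - e3 * y n ^ 3)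
  refine ⟨e3, t, ht, e2, fun h12 h4 => ?_⟩
  have e1 := leadingCoeff_one hy hc₀ hc₁ (Eventually.of_forall fun n => by
    have := hK n; unfold quadFn at this
    linear_combination this - e3 * y n ^ 3 - h12 * x n * y n ^ 2 - h4 * y n ^ 2)
  linear_combination -e1

theorem pencilMap_parallel_superset {h₀ h₁ h₂ : ℂ} {a : Fin 3 → ℂ} (hp : p 2 = 0) (t s : ℂ)
    (h2 : a 2 = h₂ * t ^ 2 + h₁ * t + h₀) (ht : (p 1 - q 2) * t + p 4 = 0)
    (hs : a 0 = (p 1 - q 2) * s + ((p 0 - q 1) * t ^ 2 + (p 3 - q 4) * t + p 5)) :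
    a ∈ asymptoticSet (pencilMap p q fun x _ => h₂ * x ^ 2 + h₁ * x + h₀) := by
  refine mem_asymptoticSet_of_path (x := fun τ => t + s * τ) (y := fun τ => τ⁻¹)
    (z := fun τ => τ * (a 1 - quadFn q (t + s * τ) τ⁻¹))
    (a := fun τ => (p 1 - q 2) * s + (p 0 - q 1) * (t + s * τ) ^ 2 + (p 3 - q 4) * (t + s * τ) +
      p 5 + τ * (p 0 * 0 - q 0 * (t + s * τ) ^ 3 - q 3 * (t + s * τ) ^ 2 - q 5 * (t + s * τ) +
        a 1 * (t + s * τ)))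
    (b := fun _ => a 1) (c := fun τ => h₂ * (t + s * τ) ^ 2 + h₁ * (t + s * τ) + h₀)
    (Or.inr (Or.inl tendsto_inv_punctured)) (by fun_prop) (by fun_prop) (by fun_prop) ?_ ?_ ?_ ?_
  · filter_upwards [self_mem_nhdsWithin] with τ hτ
    have hτ : τ ≠ 0 := hτ
    refine ⟨?_, ?_, rfl⟩
    · unfold quadFn
      field_simp
      linear_combination hp + τ * ht
    · field_simp
      ring
  · simp [hs]; ring
  · rfl
  · simp [h2]

theorem isUnionOfThree_pencilMap_parallel {h₀ h₁ h₂ : ℂ} (hne : h₁ ≠ 0 ∨ h₂ ≠ 0) :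
    IsUnionOfThree (asymptoticSet (pencilMap p q fun x _ => h₂ * x ^ 2 + h₁ * x + h₀)) := by
  have hsub := fun a => pencilMap_parallel_subset (p := p) (q := q) (h₀ := h₀) hne (a := a)
  have hhor : ∀ a : Fin 3 → ℂ, a 2 = h₀ →
      a ∈ asymptoticSet (pencilMap p q fun x _ => h₂ * x ^ 2 + h₁ * x + h₀) := fun a ha =>
    mem_pencilMap_of_horizontal (by fun_prop) (by simp [ha])
  by_cases hp : p 2 = 0
  · by_cases h12 : p 1 - q 2 = 0
    · by_cases h4 : p 4 = 0
      · refine .of_two (.inr (isIrredZeroSet_horizontal h₀)) (.inr (isIrredZeroSet_curve'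
          (h₀ := p 5) (h₁ := p 3 - q 4) (h₂ := p 0 - q 1) (k₀ := h₀) hne)) (Set.ext fun a => ⟨?_, ?_⟩)
        · intro ha
          rcases hsub a ha with h | ⟨-, t, h2, -, h0⟩
          · exact .inl h
          · exact .inr ⟨t, h0 h12 h4, h2⟩
        · rintro (h | ⟨t, h0, h2⟩)
          · exact hhor a h
          · exact pencilMap_parallel_superset hp t 0 h2 (by simp [h12, h4]) (by rw [h0]; ring)
      · refine .of_one (.inr ?_)
        convert isIrredZeroSet_horizontal h₀ using 1
        refine Set.ext fun a => ⟨fun ha => ?_, hhor a⟩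
        rcases hsub a ha with h | ⟨-, t, -, ht, -⟩
        · exact h
        · simp [h12, h4] at ht
    · have hroot : (p 1 - q 2) * (-p 4 / (p 1 - q 2)) + p 4 = 0 := by field_simp; ring
      refine .of_two (.inr (isIrredZeroSet_horizontal h₀)) (.inr (isIrredZeroSet_horizontal
        (h₂ * (-p 4 / (p 1 - q 2)) ^ 2 + h₁ * (-p 4 / (p 1 - q 2)) + h₀)))
        (Set.ext fun a => ⟨?_, ?_⟩)
      · intro ha
        rcases hsub a ha with h | ⟨-, t, h2, ht, -⟩
        · exact .inl h
        · have : t = -p 4 / (p 1 - q 2) := by field_simp; linear_combination ht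
          exact .inr (this ▸ h2)
      · rintro (h | h2)
        · exact hhor a h
        · refine pencilMap_parallel_superset hp (-p 4 / (p 1 - q 2)) ((a 0 - ((p 0 - q 1) *
            (-p 4 / (p 1 - q 2)) ^ 2 + (p 3 - q 4) * (-p 4 / (p 1 - q 2)) + p 5)) / (p 1 - q 2))
            h2 hroot ?_
          rw [mul_div_cancel₀ _ h12]; ring
  · refine .of_one (.inr ?_)
    convert isIrredZeroSet_horizontal h₀ using 1
    refine Set.ext fun a => ⟨fun ha => ?_, hhor a⟩
    rcases hsub a ha with h | ⟨h, -⟩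
    · exact h
    · exact absurd h hp

end BaseLine

section Pencil

open Bornology

variable {p q : Fin 6 → ℂ}

theorem pencilMap_parabola_subset {c : ℂ} {m : Fin 3 → ℂ}
    (hm : m ∈ asymptoticSet (pencilMap p q fun x y => x ^ 2 + y + c)) :
    m 2 = c ∨ p 2 = 0 ∧ p 1 - q 2 = 0 ∧ p 4 = p 0 - q 1 ∧ -q 0 = p 3 - q 4 ∧
      -p 4 * (m 2 - c) - q 3 - p 5 + m 0 = 0 := by
  rcases pencilMap_cases (by fun_prop) hm with h | ⟨U, x, y, u, v, hxy, hu, hv, hw, hK⟩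
  · left; simpa using h
  right
  have hW : Tendsto (fun n => x n ^ 2 + y n) U (𝓝 (m 2 - c)) := by
    simpa using hw.sub_const c
  have hx : Tendsto x U (cobounded ℂ) := by
    refine (tendsto_nhds_or_cobounded U x).resolve_left fun ⟨x₀, hx⟩ => ?_
    refine hxy x₀ (m 2 - c - x₀ ^ 2) hx ((hW.sub (hx.pow 2)).congr fun n => ?_)
    ring
  obtain ⟨W, rfl⟩ : ∃ W : ℕ → ℂ, W = fun n => x n ^ 2 + y n := ⟨_, rfl⟩
  have c0 := (((hW.pow 3).const_mul (p 2)).add ((hW.pow 2).const_mul (p 4))).add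
    ((hW.const_mul (p 5)).sub (hu.mul hW))
  have c1 := (((hW.pow 2).const_mul (p 1 - q 2)).add (hW.const_mul (p 3 - q 4))).add
    (hv.const_add (-q 5))
  have c2 := ((((hW.pow 2).const_mul (-3 * p 2)).add (hW.const_mul (p 0 - q 1))).sub
    (hW.const_mul (2 * p 4))).add (hu.const_add (-q 3 - p 5))
  have c3 := (hW.const_mul (-2 * (p 1 - q 2))).add_const (-q 0 - (p 3 - q 4))
  have c4 := (hW.const_mul (3 * p 2)).add_const (p 4 - (p 0 - q 1))
  have c5 : Tendsto (fun _ : ℕ => p 1 - q 2) U (𝓝 (p 1 - q 2)) := tendsto_const_nhds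
  have c6 : Tendsto (fun _ : ℕ => -p 2) U (𝓝 (-p 2)) := tendsto_const_nhds
  have key : ∀ n, -p 2 * x n ^ 6 + (p 1 - q 2) * x n ^ 5 +
      (3 * p 2 * (x n ^ 2 + y n) + (p 4 - (p 0 - q 1))) * x n ^ 4 +
      (-2 * (p 1 - q 2) * (x n ^ 2 + y n) + (-q 0 - (p 3 - q 4))) * x n ^ 3 +
      (-3 * p 2 * (x n ^ 2 + y n) ^ 2 + (p 0 - q 1) * (x n ^ 2 + y n) -
        2 * p 4 * (x n ^ 2 + y n) + (-q 3 - p 5 + u n)) * x n ^ 2 +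
      ((p 1 - q 2) * (x n ^ 2 + y n) ^ 2 + (p 3 - q 4) * (x n ^ 2 + y n) + (-q 5 + v n)) * x n +
      (p 2 * (x n ^ 2 + y n) ^ 3 + p 4 * (x n ^ 2 + y n) ^ 2 +
        (p 5 * (x n ^ 2 + y n) - u n * (x n ^ 2 + y n))) = 0 := fun n => by
    have := hK n; unfold quadFn at this; linear_combination this
  have e6 := leadingCoeff_six hx c0 c1 c2 c3 c4 c5 c6 (Eventually.of_forall key)
  have e6 : p 2 = 0 := by simpa using e6
  have e5 := leadingCoeff_five hx c0 c1 c2 c3 c4 c5 (Eventually.of_forall fun n => by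
    linear_combination key n + x n ^ 6 * e6)
  have e4 := leadingCoeff_four hx c0 c1 c2 c3 c4 (Eventually.of_forall fun n => by
    linear_combination key n + x n ^ 6 * e6 - x n ^ 5 * e5)
  have e4' : p 4 - (p 0 - q 1) = 0 := by simpa [e6] using e4
  have e3 := leadingCoeff_three hx c0 c1 c2 c3 (Eventually.of_forall fun n => by
    linear_combination key n + x n ^ 6 * e6 - x n ^ 5 * e5 - x n ^ 4 * (e4' +
      3 * (x n ^ 2 + y n) * e6))
  have e3' : -q 0 - (p 3 - q 4) = 0 := by simpa [e5] using e3
  have e2 := leadingCoeff_two hx c0 c1 c2 (Eventually.of_forall fun n => by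
    linear_combination key n + x n ^ 6 * e6 - x n ^ 5 * e5 - x n ^ 4 * (e4' +
      3 * (x n ^ 2 + y n) * e6) - x n ^ 3 * (e3' - 2 * (x n ^ 2 + y n) * e5))
  refine ⟨e6, e5, by linear_combination e4', by linear_combination e3', ?_⟩
  linear_combination e2 + 3 * (m 2 - c) ^ 2 * e6 + (m 2 - c) * e4'

theorem pencilMap_parabola_superset {c : ℂ} {m : Fin 3 → ℂ} (h2 : p 2 = 0) (h12 : p 1 - q 2 = 0)
    (h4 : p 4 = p 0 - q 1) (h0 : -q 0 = p 3 - q 4)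
    (hm : -p 4 * (m 2 - c) - q 3 - p 5 + m 0 = 0) :
    m ∈ asymptoticSet (pencilMap p q fun x y => x ^ 2 + y + c) := by
  have hev : ∀ᶠ τ : ℂ in 𝓝[≠] 0, (m 2 - c) * τ ^ 2 - 1 ≠ 0 := by
    refine (ContinuousAt.eventually_ne (by fun_prop) ?_).filter_mono nhdsWithin_le_nhds
    simp
  refine mem_asymptoticSet_of_path (x := fun τ => τ⁻¹) (y := fun τ => m 2 - c - τ⁻¹ ^ 2)
    (z := fun τ => (m 1 - quadFn q τ⁻¹ (m 2 - c - τ⁻¹ ^ 2)) / (m 2 - c - τ⁻¹ ^ 2))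
    (a := fun τ => m 0 + (((p 3 - q 4) * (m 2 - c) - q 5 + m 1) * τ +
      (p 4 * (m 2 - c) ^ 2 + p 5 * (m 2 - c) - m 0 * (m 2 - c)) * τ ^ 2) /
        ((m 2 - c) * τ ^ 2 - 1))
    (b := fun _ => m 1) (c := fun τ => m 2)
    (Or.inl tendsto_inv_punctured) ?_ (by fun_prop) (by fun_prop) ?_ (by simp) rfl rfl
  · refine ContinuousAt.add (by fun_prop) (ContinuousAt.div (by fun_prop) (by fun_prop) (by simp))
  · filter_upwards [self_mem_nhdsWithin, hev] with τ hτ hd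
    have hτ : τ ≠ 0 := hτ
    have hy : m 2 - c - τ⁻¹ ^ 2 ≠ 0 := by
      have : m 2 - c - τ⁻¹ ^ 2 = ((m 2 - c) * τ ^ 2 - 1) / τ ^ 2 := by field_simp
      rw [this]; positivity
    have key : (m 2 - c - τ⁻¹ ^ 2) * quadFn p τ⁻¹ (m 2 - c - τ⁻¹ ^ 2) -
        τ⁻¹ * quadFn q τ⁻¹ (m 2 - c - τ⁻¹ ^ 2) + m 1 * τ⁻¹ = m 0 * (m 2 - c - τ⁻¹ ^ 2) +
        (((p 3 - q 4) * (m 2 - c) - q 5 + m 1) * τ⁻¹ +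
        (p 4 * (m 2 - c) ^ 2 + p 5 * (m 2 - c) - m 0 * (m 2 - c))) := by
      unfold quadFn
      generalize τ⁻¹ = X
      linear_combination (-X ^ 6 + 3 * (m 2 - c) * X ^ 4 - 3 * (m 2 - c) ^ 2 * X ^ 2 +
        (m 2 - c) ^ 3) * h2 + (X ^ 5 - 2 * (m 2 - c) * X ^ 3 + (m 2 - c) ^ 2 * X) * h12 +
        (X ^ 4 - (m 2 - c) * X ^ 2) * h4 + X ^ 3 * h0 + X ^ 2 * hm
    have e1 : (m 2 - c) * τ ^ 2 - 1 = (m 2 - c - τ⁻¹ ^ 2) * τ ^ 2 := by field_simp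
    have e2 : ((p 3 - q 4) * (m 2 - c) - q 5 + m 1) * τ +
        (p 4 * (m 2 - c) ^ 2 + p 5 * (m 2 - c) - m 0 * (m 2 - c)) * τ ^ 2 =
        (((p 3 - q 4) * (m 2 - c) - q 5 + m 1) * τ⁻¹ +
        (p 4 * (m 2 - c) ^ 2 + p 5 * (m 2 - c) - m 0 * (m 2 - c))) * τ ^ 2 := by field_simp
    refine ⟨?_, ?_, by ring⟩
    · rw [e1, e2, mul_div_mul_right _ _ (pow_ne_zero 2 hτ), eq_comm, ← sub_eq_zero]
      generalize quadFn p τ⁻¹ (m 2 - c - τ⁻¹ ^ 2) = P at key ⊢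
      generalize quadFn q τ⁻¹ (m 2 - c - τ⁻¹ ^ 2) = Q at key ⊢
      generalize m 2 - c - τ⁻¹ ^ 2 = Y at key hy ⊢
      generalize τ⁻¹ = X at key ⊢
      field_simp
      linear_combination -key
    · rw [mul_div_cancel₀ _ hy]; ring

theorem isUnionOfThree_pencilMap_parabola (c : ℂ) :
    IsUnionOfThree (asymptoticSet (pencilMap p q fun x y => x ^ 2 + y + c)) := by
  have hhor : ∀ m : Fin 3 → ℂ, m 2 = c →
      m ∈ asymptoticSet (pencilMap p q fun x y => x ^ 2 + y + c) := fun m hm =>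
    mem_pencilMap_of_horizontal (by fun_prop) (by simp [hm])
  by_cases h : p 2 = 0 ∧ p 1 - q 2 = 0 ∧ p 4 = p 0 - q 1 ∧ -q 0 = p 3 - q 4
  · obtain ⟨h2, h12, h4, h0⟩ := h
    refine .of_two (.inr (isIrredZeroSet_horizontal c)) (Z₂ := {m | -p 4 * (m 2 - c) - q 3 - p 5 +
      m 0 = 0}) (.inr (isIrredZeroSet_of_plane (a := 1) (b := 0) (c := -p 4)
        (d := p 4 * c - q 3 - p 5) (by simp) fun m => ?_)) (Set.ext fun m => ⟨?_, ?_⟩)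
    · rw [Set.mem_ofPred_eq]; constructor <;> intro h <;> linear_combination h
    · intro hm
      rcases pencilMap_parabola_subset hm with h | ⟨-, -, -, -, h⟩
      · exact .inl h
      · exact .inr h
    · rintro (hm | hm)
      · exact hhor m hm
      · exact pencilMap_parabola_superset h2 h12 h4 h0 hm
  · refine .of_one (.inr ?_)
    convert isIrredZeroSet_horizontal c using 1
    refine Set.ext fun m => ⟨fun hm => ?_, hhor m⟩
    rcases pencilMap_parabola_subset hm with h' | ⟨h2, h12, h4, h0, -⟩
    · exact h'
    · exact absurd ⟨h2, h12, h4, h0⟩ h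

/-- The coefficients of the polynomial with the two variables exchanged. -/
def quadSwap (p : Fin 6 → ℂ) : Fin 6 → ℂ := ![p 2, p 1, p 0, p 4, p 3, p 5]

theorem quadFn_quadSwap (p : Fin 6 → ℂ) (x y : ℂ) : quadFn (quadSwap p) x y = quadFn p y x := by
  simp [quadFn, quadSwap]; ring

theorem mem_pencilMap_swap {B : ℂ → ℂ → ℂ} {m : Fin 3 → ℂ}
    (hm : m ∈ asymptoticSet (pencilMap p q B)) : ![m 1, m 0, m 2] ∈
      asymptoticSet (pencilMap (quadSwap q) (quadSwap p) fun x y => B y x) := by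
  obtain ⟨ξ, hξ, hF⟩ := hm
  rw [tendsto_pi_nhds] at hF
  refine ⟨fun k => ![ξ k 1, ξ k 0, ξ k 2], ?_, ?_⟩
  · refine tendsto_atTop_mono (fun k => ?_) hξ
    rw [pi_norm_le_iff_of_nonneg (norm_nonneg _)]
    intro i
    fin_cases i
    · exact norm_le_pi_norm ![ξ k 1, ξ k 0, ξ k 2] 1
    · exact norm_le_pi_norm ![ξ k 1, ξ k 0, ξ k 2] 0
    · exact norm_le_pi_norm ![ξ k 1, ξ k 0, ξ k 2] 2
  · rw [tendsto_pi_nhds]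
    intro i
    fin_cases i
    · simpa [pencilMap, mkMap, quadFn_quadSwap] using hF 1
    · simpa [pencilMap, mkMap, quadFn_quadSwap] using hF 0
    · simpa [pencilMap, mkMap, quadFn_quadSwap] using hF 2

/-- The part of the asymptotic set of `(x * z + p, y * z + q, (x + b) * (y + a) + c)` that comes
from `x` tending to infinity. -/
def hyperbolaBranch (p q : Fin 6 → ℂ) (a c : ℂ) : Set (Fin 3 → ℂ) :=
  {m | q 0 = 0 ∧ q 3 + a * (p 0 - q 1) = 0 ∧
    (p 0 - q 1) * (m 2 - c) + (p 1 - q 2) * a ^ 2 - a * (p 3 - q 4) - q 5 + m 1 = 0}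

theorem hyperbolaBranch_cases (p q : Fin 6 → ℂ) (a c : ℂ) :
    hyperbolaBranch p q a c = ∅ ∨ IsIrredZeroSet (hyperbolaBranch p q a c) := by
  by_cases h : q 0 = 0 ∧ q 3 + a * (p 0 - q 1) = 0
  · refine .inr (isIrredZeroSet_of_plane (a := 0) (b := 1) (c := p 0 - q 1)
      (d := -(p 0 - q 1) * c + (p 1 - q 2) * a ^ 2 - a * (p 3 - q 4) - q 5) (by simp) fun m => ?_)
    refine ⟨fun ⟨_, _, hm⟩ => by linear_combination hm, fun hm => ⟨h.1, h.2, ?_⟩⟩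
    linear_combination hm
  · exact .inl (Set.eq_empty_of_forall_notMem fun m hm => h ⟨hm.1, hm.2.1⟩)

theorem mem_hyperbolaBranch_of_tendsto {U : Ultrafilter ℕ} {x y u v : ℕ → ℂ} {a b c : ℂ}
    {m : Fin 3 → ℂ} (hx : Tendsto x U (cobounded ℂ)) (hu : Tendsto u U (𝓝 (m 0)))
    (hv : Tendsto v U (𝓝 (m 1)))
    (hw : Tendsto (fun n => (x n + b) * (y n + a) + c) U (𝓝 (m 2)))
    (hK : ∀ n, y n * quadFn p (x n) (y n) - x n * quadFn q (x n) (y n) +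
      v n * x n - u n * y n = 0) : m ∈ hyperbolaBranch p q a c := by
  have hW : Tendsto (fun n => (x n + b) * (y n + a)) U (𝓝 (m 2 - c)) := by
    simpa using hw.sub_const c
  have hxb : Tendsto (fun n => x n + b) U (cobounded ℂ) := by
    have := tendsto_add_const_cobounded b |>.comp hx
    exact this
  have hs : Tendsto (fun n => y n + a) U (𝓝 0) := by
    have h := hW.mul (tendsto_inv₀_cobounded.comp hxb)
    rw [mul_zero] at h
    refine h.congr' ?_
    filter_upwards [hxb.eventually_ne_cobounded 0] with n hn
    simp only [Function.comp]
    field_simp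
  have hy : Tendsto y U (𝓝 (-a)) := by simpa using hs.sub_const a
  have c0 := ((((hy.pow 3).const_mul (p 2)).add ((hy.pow 2).const_mul (p 4))).add
    (hy.const_mul (p 5))).sub (hu.mul hy)
  have c1 := (((hy.pow 2).const_mul (p 1 - q 2)).add (hy.const_mul (p 3 - q 4))).add
    (hv.const_add (-q 5))
  have c2 := (hy.const_mul (p 0 - q 1)).add_const (-q 3)
  have e3 := leadingCoeff_three hx c0 c1 c2 (tendsto_const_nhds (x := -q 0))
    (Eventually.of_forall fun n => by
      have := hK n; unfold quadFn at this; linear_combination this)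
  have e2 := leadingCoeff_two hx c0 c1 c2 (Eventually.of_forall fun n => by
    have := hK n; unfold quadFn at this; linear_combination this - e3 * x n ^ 3)
  have e1 := leadingCoeff_one hx c0 (((hW.sub (hs.const_mul b)).const_mul (p 0 - q 1)).add c1)
    (Eventually.of_forall fun n => by
      have := hK n; unfold quadFn at this
      linear_combination this - e3 * x n ^ 3 - e2 * x n ^ 2)
  exact ⟨by linear_combination -e3, by linear_combination -e2, by linear_combination e1⟩

theorem hyperbolaBranch_subset (a b c : ℂ) : hyperbolaBranch p q a c ⊆
    asymptoticSet (pencilMap p q fun x y => (x + b) * (y + a) + c) := by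
  rintro m ⟨h0, h3, hm⟩
  have hev : ∀ᶠ τ : ℂ in 𝓝[≠] 0, 1 + b * τ ≠ 0 := by
    refine (ContinuousAt.eventually_ne (by fun_prop) ?_).filter_mono nhdsWithin_le_nhds
    simp
  obtain ⟨s, hs⟩ : ∃ s : ℂ → ℂ, s = fun τ => (m 2 - c) * τ / (1 + b * τ) := ⟨_, rfl⟩
  have hsc : ContinuousAt s 0 := by
    rw [hs]; exact ContinuousAt.div (by fun_prop) (by fun_prop) (by simp)
  have hs0 : s 0 = 0 := by simp [hs]
  refine mem_asymptoticSet_of_path (x := fun τ => τ⁻¹) (y := fun τ => s τ - a)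
    (z := fun τ => (m 0 - quadFn p τ⁻¹ (s τ - a)) * τ)
    (a := fun τ => m 0) (b := fun τ => - ((p 0 - q 1) * (m 2 - c - b * s τ) + (p 1 - q 2) *
      (s τ - a) ^ 2 + (p 3 - q 4) * (s τ - a) - q 5) - τ * (p 2 * (s τ - a) ^ 3 + p 4 *
      (s τ - a) ^ 2 + p 5 * (s τ - a) - m 0 * (s τ - a))) (c := fun τ => m 2)
    (Or.inl tendsto_inv_punctured) (by fun_prop) (by fun_prop) (by fun_prop) ?_ rfl ?_ rfl
  · filter_upwards [self_mem_nhdsWithin, hev] with τ hτ hd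
    have hτ : τ ≠ 0 := hτ
    have hsτ : s τ * (τ⁻¹ + b) = m 2 - c := by
      have : τ⁻¹ + b = (1 + b * τ) / τ := by field_simp
      rw [hs, this, div_mul_div_cancel₀ hd, mul_div_assoc, div_self hτ, mul_one]
    refine ⟨?_, ?_, by linear_combination hsτ⟩
    · field_simp; ring
    · have hX := mul_inv_cancel₀ hτ
      have key : (s τ - a) * (m 0 - quadFn p τ⁻¹ (s τ - a)) + τ⁻¹ * (quadFn q τ⁻¹ (s τ - a) +
          ((p 0 - q 1) * (m 2 - c - b * s τ) + (p 1 - q 2) * (s τ - a) ^ 2 +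
          (p 3 - q 4) * (s τ - a) - q 5)) + (p 2 * (s τ - a) ^ 3 + p 4 * (s τ - a) ^ 2 +
          p 5 * (s τ - a) - m 0 * (s τ - a)) = 0 := by
        unfold quadFn
        generalize τ⁻¹ = X at hsτ ⊢
        linear_combination X ^ 3 * h0 + X ^ 2 * h3 - X * (p 0 - q 1) * hsτ
      linear_combination τ * key - (quadFn q τ⁻¹ (s τ - a) +
          ((p 0 - q 1) * (m 2 - c - b * s τ) + (p 1 - q 2) * (s τ - a) ^ 2 +
          (p 3 - q 4) * (s τ - a) - q 5)) * hX
  · simp only [hs0]; linear_combination -hm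

theorem isUnionOfThree_pencilMap_hyperbola (a b c : ℂ) :
    IsUnionOfThree (asymptoticSet (pencilMap p q fun x y => (x + b) * (y + a) + c)) := by
  refine ⟨{m | m 2 = b * a + c}, hyperbolaBranch p q a c,
    (fun m => (!![0, 1, 0; 1, 0, 0; 0, 0, 1] : Matrix (Fin 3) (Fin 3) ℂ).mulVec m) ⁻¹'
      hyperbolaBranch (quadSwap q) (quadSwap p) b c, ?_⟩
  have hmul : ∀ m : Fin 3 → ℂ, (!![0, 1, 0; 1, 0, 0; 0, 0, 1] : Matrix (Fin 3) (Fin 3) ℂ).mulVec m =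
      ![m 1, m 0, m 2] := fun m => by
    ext i; fin_cases i <;> simp [Matrix.mulVec, dotProduct, Fin.sum_univ_three]
  have hswap' : (fun x y : ℂ => (y + a) * (x + b) + c) = fun x y => (x + b) * (y + a) + c := by
    ext x y; ring
  have hquad : ∀ p : Fin 6 → ℂ, quadSwap (quadSwap p) = p := fun p => by
    ext i; fin_cases i <;> rfl
  refine ⟨.inr (isIrredZeroSet_horizontal _), hyperbolaBranch_cases _ _ _ _, ?_,
    Set.ext fun m => ⟨fun hm => ?_, ?_⟩⟩
  · rcases hyperbolaBranch_cases (quadSwap q) (quadSwap p) b c with h | h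
    · left; rw [h, Set.preimage_empty]
    · exact .inr (h.preimage (by simp [Matrix.det_fin_three]))
  · rcases pencilMap_cases (by fun_prop) hm with h | ⟨U, x, y, u, v, hxy, hu, hv, hw, hK⟩
    · left; left; simpa using h
    · rcases tendsto_nhds_or_cobounded U x with ⟨x₀, hx⟩ | hx
      · right
        rw [Set.mem_preimage, hmul]
        refine mem_hyperbolaBranch_of_tendsto (b := a)
          ((tendsto_nhds_or_cobounded U y).resolve_left fun ⟨y₀, hy⟩ => hxy x₀ y₀ hx hy)
          (u := v) (v := u) (y := x) hv hu ?_ fun n => ?_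
        · refine hw.congr fun n => by ring
        · rw [quadFn_quadSwap, quadFn_quadSwap]; linear_combination -hK n
      · exact .inl (.inr (mem_hyperbolaBranch_of_tendsto hx hu hv hw hK))
  · rintro ((hm | hm) | hm)
    · exact mem_pencilMap_of_horizontal (by fun_prop) (by simpa using hm)
    · exact hyperbolaBranch_subset a b c hm
    · rw [Set.mem_preimage, hmul] at hm
      have := mem_pencilMap_swap (hyperbolaBranch_subset b a c hm)
      rw [hquad, hquad, hswap'] at this
      convert this using 1
      ext i; fin_cases i <;> rfl

end Pencil

section Changes

open Bornology

theorem asymptoticSet_comp {n : ℕ} {F φ ψ : (Fin n → ℂ) → (Fin n → ℂ)} (hφ : Continuous φ)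
    (hψ : Continuous ψ) (h₁ : ∀ p, ψ (φ p) = p) (h₂ : ∀ p, φ (ψ p) = p) :
    asymptoticSet (fun p => F (φ p)) = asymptoticSet F := by
  have key : ∀ {G φ ψ : (Fin n → ℂ) → (Fin n → ℂ)}, Continuous φ → Continuous ψ →
      (∀ p, ψ (φ p) = p) → (∀ p, φ (ψ p) = p) →
      asymptoticSet (fun p => G (φ p)) ⊆ asymptoticSet G := by
    rintro G φ ψ hφ hψ h₁ h₂ a ⟨ξ, hξ, hG⟩
    refine ⟨fun k => φ (ξ k), ?_, hG⟩
    rw [tendsto_norm_atTop_iff_cobounded, Metric.cobounded_eq_cocompact] at hξ ⊢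
    exact (Homeomorph.mk ⟨φ, ψ, h₁, h₂⟩ hφ hψ).isClosedEmbedding.tendsto_cocompact.comp hξ
  refine (key hφ hψ h₁ h₂).antisymm ?_
  simpa [h₂] using key (G := fun p => F (φ p)) hψ hφ h₂ h₁

theorem asymptoticSet_mulVec {n : ℕ} {F : (Fin n → ℂ) → (Fin n → ℂ)}
    {M : Matrix (Fin n) (Fin n) ℂ} (hM : M.det ≠ 0) :
    asymptoticSet F = (fun p => M.mulVec p) ⁻¹' asymptoticSet fun p => M.mulVec (F p) := by
  have hu : IsUnit M.det := isUnit_iff_ne_zero.mpr hM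
  ext a
  constructor
  · rintro ⟨ξ, hξ, hF⟩
    exact ⟨ξ, hξ, ((Continuous.matrix_mulVec continuous_const continuous_id).tendsto a).comp hF⟩
  · rintro ⟨ξ, hξ, hF⟩
    refine ⟨ξ, hξ, ?_⟩
    have := ((Continuous.matrix_mulVec (continuous_const (y := M⁻¹)) continuous_id).tendsto
      (M.mulVec a)).comp hF
    simpa [Function.comp_def, Matrix.mulVec_mulVec, Matrix.nonsing_inv_mul _ hu] using this

theorem IsUnionOfThree.of_mulVec {F : (Fin 3 → ℂ) → (Fin 3 → ℂ)} {M : Matrix (Fin 3) (Fin 3) ℂ}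
    (hM : M.det ≠ 0) (h : IsUnionOfThree (asymptoticSet fun p => M.mulVec (F p))) :
    IsUnionOfThree (asymptoticSet F) := by
  rw [asymptoticSet_mulVec hM]
  exact h.preimage hM

theorem IsUnionOfThree.of_target_change {f g h f' g' h' : ℂ → ℂ → ℂ → ℂ}
    {M : Matrix (Fin 3) (Fin 3) ℂ} (hM : M.det ≠ 0)
    (hf : ∀ x y z, f' x y z = M 0 0 * f x y z + M 0 1 * g x y z + M 0 2 * h x y z)
    (hg : ∀ x y z, g' x y z = M 1 0 * f x y z + M 1 1 * g x y z + M 1 2 * h x y z)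
    (hh : ∀ x y z, h' x y z = M 2 0 * f x y z + M 2 1 * g x y z + M 2 2 * h x y z)
    (H : IsUnionOfThree (asymptoticSet (mkMap f' g' h'))) :
    IsUnionOfThree (asymptoticSet (mkMap f g h)) := by
  refine .of_mulVec hM ?_
  convert H using 2
  ext p i
  fin_cases i <;> simp [mkMap, Matrix.mulVec, dotProduct, Fin.sum_univ_three, hf, hg, hh]

/-- An affine change of the first two coordinates. -/
def affineChange (α β γ α' β' γ' : ℂ) (p : Fin 3 → ℂ) : Fin 3 → ℂ :=
  ![α * p 0 + β * p 1 + γ, α' * p 0 + β' * p 1 + γ', p 2]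

theorem continuous_affineChange (α β γ α' β' γ' : ℂ) :
    Continuous (affineChange α β γ α' β' γ') := by
  unfold affineChange
  refine continuous_pi fun i => ?_
  fin_cases i <;> simp <;> fun_prop

theorem exists_inverse_affineChange {α β γ α' β' γ' : ℂ} (hD : α * β' - β * α' ≠ 0) :
    ∃ ψ, Continuous ψ ∧ (∀ p, ψ (affineChange α β γ α' β' γ' p) = p) ∧
      ∀ p, affineChange α β γ α' β' γ' (ψ p) = p := by
  obtain ⟨D, hD'⟩ : ∃ D, D = α * β' - β * α' := ⟨_, rfl⟩
  rw [← hD'] at hD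
  refine ⟨affineChange (β' / D) (-β / D) ((β * γ' - β' * γ) / D) (-α' / D) (α / D)
    ((α' * γ - α * γ') / D), continuous_affineChange _ _ _ _ _ _, fun p => ?_, fun p => ?_⟩
  all_goals
    ext i
    fin_cases i
    · simp [affineChange]; field_simp; rw [hD']; ring
    · simp [affineChange]; field_simp; rw [hD']; ring
    · rfl

theorem asymptoticSet_mkMap_affine (f g h : ℂ → ℂ → ℂ → ℂ) {α β γ α' β' γ' : ℂ}
    (hD : α * β' - β * α' ≠ 0) :
    asymptoticSet (mkMap (fun x y z => f (α * x + β * y + γ) (α' * x + β' * y + γ') z)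
      (fun x y z => g (α * x + β * y + γ) (α' * x + β' * y + γ') z)
      (fun x y z => h (α * x + β * y + γ) (α' * x + β' * y + γ') z)) =
      asymptoticSet (mkMap f g h) := by
  obtain ⟨ψ, hψ, h₁, h₂⟩ := exists_inverse_affineChange (γ := γ) (γ' := γ') hD
  exact asymptoticSet_comp (F := mkMap f g h) (continuous_affineChange _ _ _ _ _ _) hψ h₁ h₂

theorem quadFn_combination (s t : ℂ) (p q : Fin 6 → ℂ) (x y : ℂ) :
    quadFn (s • p + t • q) x y = s * quadFn p x y + t * quadFn q x y := by
  simp [quadFn]; ring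

theorem exists_quadFn_affine (p : Fin 6 → ℂ) (α β γ α' β' γ' : ℂ) :
    ∃ p', ∀ x y, quadFn p' x y = quadFn p (α * x + β * y + γ) (α' * x + β' * y + γ') := by
  refine ⟨![p 0 * α ^ 2 + p 1 * (α * α') + p 2 * α' ^ 2,
    2 * p 0 * α * β + p 1 * (α * β' + β * α') + 2 * p 2 * α' * β',
    p 0 * β ^ 2 + p 1 * (β * β') + p 2 * β' ^ 2,
    2 * p 0 * α * γ + p 1 * (α * γ' + γ * α') + 2 * p 2 * α' * γ' + p 3 * α + p 4 * α',
    2 * p 0 * β * γ + p 1 * (β * γ' + γ * β') + 2 * p 2 * β' * γ' + p 3 * β + p 4 * β',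
    quadFn p γ γ'], fun x y => ?_⟩
  simp [quadFn]
  ring

/-- All the mappings `(x * z + p, y * z + q, B)` have asymptotic sets of the expected form. -/
def IsGoodPencil (B : ℂ → ℂ → ℂ) : Prop :=
  ∀ p q, IsUnionOfThree (asymptoticSet (pencilMap p q B))

theorem IsGoodPencil.comp {B : ℂ → ℂ → ℂ} (hB : IsGoodPencil B) {α β γ δ : ℂ}
    (hD : α * δ - β * γ ≠ 0) : IsGoodPencil fun x y => B (α * x + β * y) (γ * x + δ * y) := by
  intro p q
  obtain ⟨D, hD'⟩ : ∃ D, D = α * δ - β * γ := ⟨_, rfl⟩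
  have hD₀ : D ≠ 0 := hD' ▸ hD
  obtain ⟨p', hp'⟩ := exists_quadFn_affine (α • p + β • q) (δ / D)
    (-β / D) 0 (-γ / D) (α / D) 0
  obtain ⟨q', hq'⟩ := exists_quadFn_affine (γ • p + δ • q) (δ / D)
    (-β / D) 0 (-γ / D) (α / D) 0
  have hx : ∀ x y : ℂ, δ / D * (α * x + β * y + 0) +
      -β / D * (γ * x + δ * y + 0) + 0 = x := fun x y => by field_simp; rw [hD']; ring
  have hy : ∀ x y : ℂ, -γ / D * (α * x + β * y + 0) +
      α / D * (γ * x + δ * y + 0) + 0 = y := fun x y => by field_simp; rw [hD']; ring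
  have h := hB p' q'
  unfold pencilMap at h ⊢
  rw [← asymptoticSet_mkMap_affine _ _ _ (γ := 0) (γ' := 0) hD] at h
  refine .of_target_change (M := !![α, β, 0; γ, δ, 0; 0, 0, 1]) ?_ ?_ ?_ ?_ h
  · simpa [Matrix.det_fin_three] using hD
  · intro x y z
    rw [hp', hx, hy, quadFn_combination]
    simp; ring
  · intro x y z
    rw [hq', hx, hy, quadFn_combination]
    simp; ring
  · intro x y z
    simp

theorem IsGoodPencil.const_mul {B : ℂ → ℂ → ℂ} (hB : IsGoodPencil B) {ρ : ℂ} (hρ : ρ ≠ 0) :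
    IsGoodPencil fun x y => ρ * B x y := by
  intro p q
  refine .of_target_change (M := !![1, 0, 0; 0, 1, 0; 0, 0, ρ⁻¹]) ?_ ?_ ?_ ?_ (hB p q)
  · simpa [Matrix.det_fin_three] using hρ
  · intro x y z; simp
  · intro x y z; simp
  · intro x y z; simp [hρ]

theorem exists_linear_factors (a b c : ℂ) :
    ∃ α β γ δ : ℂ, ∀ x y : ℂ, a * x ^ 2 + b * (x * y) + c * y ^ 2 =
      (α * x + β * y) * (γ * x + δ * y) := by
  by_cases ha : a = 0
  · exact ⟨0, 1, b, c, fun x y => by rw [ha]; ring⟩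
  · obtain ⟨t, ht⟩ := exists_quadratic_eq (a := a) (b := b) (.inl ha) (-c)
    exact ⟨1, -t, a, a * t + b, fun x y => by linear_combination y ^ 2 * ht⟩

theorem isGoodPencil_of_linear {h₀ h₁ h₂ α β : ℂ} (hne : h₁ ≠ 0 ∨ h₂ ≠ 0)
    (hα : α ≠ 0 ∨ β ≠ 0) :
    IsGoodPencil fun x y => h₂ * (α * x + β * y) ^ 2 + h₁ * (α * x + β * y) + h₀ := by
  have h : IsGoodPencil fun x _ => h₂ * x ^ 2 + h₁ * x + h₀ :=
    fun _ _ => isUnionOfThree_pencilMap_parallel hne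
  rcases hα with hα | hβ
  · exact h.comp (γ := 0) (δ := 1) (by simpa using hα)
  · exact h.comp (γ := 1) (δ := 0) (by simpa using hβ)

theorem exists_proportional {α β γ δ : ℂ} (h : α ≠ 0 ∨ β ≠ 0) (hD : α * δ - β * γ = 0) :
    ∃ r, γ = r * α ∧ δ = r * β := by
  rcases h with h | h
  · exact ⟨γ / α, by field_simp, by field_simp; linear_combination hD⟩
  · exact ⟨δ / β, by field_simp; linear_combination -hD, by field_simp⟩

theorem isGoodPencil_quadFn {b : Fin 6 → ℂ} (hb : ∃ x y, quadFn b x y ≠ b 5) :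
    IsGoodPencil (quadFn b) := by
  obtain ⟨α, β, γ, δ, h⟩ := exists_linear_factors (b 0) (b 1) (b 2)
  have hB : ∀ x y, quadFn b x y = (α * x + β * y) * (γ * x + δ * y) + b 3 * x + b 4 * y + b 5 :=
    fun x y => by rw [← h]; rfl
  by_cases hD : α * δ - β * γ = 0
  swap
  · obtain ⟨D, hD'⟩ : ∃ D, D = α * δ - β * γ := ⟨_, rfl⟩
    have hD₀ : D ≠ 0 := hD' ▸ hD
    have hyp : IsGoodPencil fun x y => (x + (b 4 * α - b 3 * β) / D) *
        (y + (b 3 * δ - b 4 * γ) / D) + (b 5 - (b 4 * α - b 3 * β) / D *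
        ((b 3 * δ - b 4 * γ) / D)) := fun _ _ => isUnionOfThree_pencilMap_hyperbola _ _ _
    convert hyp.comp hD using 3 with x y
    rw [hB]
    field_simp
    rw [hD']
    ring
  by_cases hL : (α ≠ 0 ∨ β ≠ 0) ∧ (γ ≠ 0 ∨ δ ≠ 0)
  swap
  · have hB' : ∀ x y, quadFn b x y = 0 * (b 3 * x + b 4 * y) ^ 2 + 1 * (b 3 * x + b 4 * y) + b 5 := by
      intro x y
      rw [hB]
      rcases not_and_or.mp hL with h | h <;> push Not at h <;> rw [h.1, h.2] <;> ring
    have := isGoodPencil_of_linear (h₀ := b 5) (h₁ := 1) (h₂ := 0) (α := b 3) (β := b 4)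
      (by simp) ?_
    · convert this using 3 with x y
      rw [hB']
    · by_contra! h0
      obtain ⟨x, y, hxy⟩ := hb
      exact hxy (by rw [hB', h0.1, h0.2]; ring)
  obtain ⟨r, rfl, rfl⟩ := exists_proportional hL.1 hD
  have hr : r ≠ 0 := by
    rintro rfl
    simp at hL
  by_cases hE : α * b 4 - β * b 3 = 0
  · obtain ⟨s, h3, h4⟩ := exists_proportional hL.1 hE
    convert isGoodPencil_of_linear (h₀ := b 5) (h₁ := s) (.inr hr) hL.1 using 3 with x y
    rw [hB, h3, h4]
    ring
  · have hpar : IsGoodPencil fun x y => x ^ 2 + y + b 5 / r :=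
      fun _ _ => isUnionOfThree_pencilMap_parabola _
    have hdet : α * (b 4 / r) - β * (b 3 / r) ≠ 0 := by
      rw [show α * (b 4 / r) - β * (b 3 / r) = (α * b 4 - β * b 3) / r by ring]
      exact div_ne_zero hE hr
    convert (hpar.comp hdet).const_mul hr using 3 with x y
    rw [hB]
    field_simp
    ring

end Changes

section Tame

open Bornology

/-- If the mapping has a dense image then its asymptotic set has the expected form. -/
def IsTame (F : (Fin 3 → ℂ) → (Fin 3 → ℂ)) : Prop :=
  Dense (Set.range F) → IsUnionOfThree (asymptoticSet F)

theorem IsTame.of_mulVec {F : (Fin 3 → ℂ) → (Fin 3 → ℂ)} {M : Matrix (Fin 3) (Fin 3) ℂ}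
    (hM : M.det ≠ 0) (h : IsTame fun p => M.mulVec (F p)) : IsTame F := by
  intro hF
  refine .of_mulVec hM (h ?_)
  have hu : IsUnit M.det := isUnit_iff_ne_zero.mpr hM
  have hs : Function.Surjective fun p : Fin 3 → ℂ => M.mulVec p := fun p =>
    ⟨M⁻¹.mulVec p, by simp [Matrix.mulVec_mulVec, Matrix.mul_nonsing_inv _ hu]⟩
  exact hs.denseRange.comp hF (Continuous.matrix_mulVec continuous_const continuous_id)

theorem IsTame.of_target_change {f g h f' g' h' : ℂ → ℂ → ℂ → ℂ}
    {M : Matrix (Fin 3) (Fin 3) ℂ} (hM : M.det ≠ 0)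
    (hf : ∀ x y z, f' x y z = M 0 0 * f x y z + M 0 1 * g x y z + M 0 2 * h x y z)
    (hg : ∀ x y z, g' x y z = M 1 0 * f x y z + M 1 1 * g x y z + M 1 2 * h x y z)
    (hh : ∀ x y z, h' x y z = M 2 0 * f x y z + M 2 1 * g x y z + M 2 2 * h x y z)
    (H : IsTame (mkMap f' g' h')) : IsTame (mkMap f g h) := by
  refine .of_mulVec hM ?_
  convert H using 1
  ext p i
  fin_cases i <;> simp [mkMap, Matrix.mulVec, dotProduct, Fin.sum_univ_three, hf, hg, hh]

theorem IsTame.of_comp {F φ ψ : (Fin 3 → ℂ) → (Fin 3 → ℂ)} (hφ : Continuous φ)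
    (hψ : Continuous ψ) (h₁ : ∀ p, ψ (φ p) = p) (h₂ : ∀ p, φ (ψ p) = p)
    (h : IsTame fun p => F (φ p)) : IsTame F := by
  intro hF
  rw [← asymptoticSet_comp (F := F) hφ hψ h₁ h₂]
  refine h ?_
  rwa [show Set.range (fun p => F (φ p)) = Set.range F from
    (Function.LeftInverse.surjective h₂).range_comp F]

theorem IsTame.of_affine (f g h : ℂ → ℂ → ℂ → ℂ) {α β γ α' β' γ' : ℂ}
    (hD : α * β' - β * α' ≠ 0)
    (H : IsTame (mkMap (fun x y z => f (α * x + β * y + γ) (α' * x + β' * y + γ') z)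
      (fun x y z => g (α * x + β * y + γ) (α' * x + β' * y + γ') z)
      (fun x y z => h (α * x + β * y + γ) (α' * x + β' * y + γ') z))) :
    IsTame (mkMap f g h) := by
  obtain ⟨ψ, hψ, h₁, h₂⟩ := exists_inverse_affineChange (γ := γ) (γ' := γ') hD
  exact .of_comp (continuous_affineChange _ _ _ _ _ _) hψ h₁ h₂ H

theorem IsTame.of_range_subset {F : (Fin 3 → ℂ) → (Fin 3 → ℂ)} {Z : Set (Fin 3 → ℂ)}
    (hZ : IsIrredZeroSet Z) (h : Set.range F ⊆ Z) : IsTame F :=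
  fun hF => absurd (hF.mono h) hZ.not_dense

theorem ultrafilter_cases {U : Ultrafilter ℕ} {x y : ℕ → ℂ}
    (h : ∀ x₀ y₀, Tendsto x U (𝓝 x₀) → ¬ Tendsto y U (𝓝 y₀)) :
    (∃ r, Tendsto x U (cobounded ℂ) ∧ Tendsto (fun n => y n / x n) U (𝓝 r)) ∨
      (Tendsto y U (cobounded ℂ) ∧ Tendsto (fun n => x n / y n) U (𝓝 0)) := by
  rcases tendsto_nhds_or_cobounded U y with ⟨y₀, hy⟩ | hy
  · have hx := (tendsto_nhds_or_cobounded U x).resolve_left fun ⟨x₀, hx⟩ => h x₀ y₀ hx hy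
    exact .inl ⟨y₀ * 0, hx, hy.mul (tendsto_inv₀_cobounded.comp hx)⟩
  rcases tendsto_nhds_or_cobounded U x with ⟨x₀, hx⟩ | hx
  · refine .inr ⟨hy, ?_⟩
    have := hx.mul (tendsto_inv₀_cobounded.comp hy)
    rwa [mul_zero] at this
  rcases tendsto_nhds_or_cobounded U (fun n => x n / y n) with ⟨r, hr⟩ | hr
  · by_cases h0 : r = 0
    · exact .inr ⟨hy, h0 ▸ hr⟩
    · refine .inl ⟨r⁻¹, hx, (hr.inv₀ h0).congr fun n => inv_div _ _⟩
  · exact .inl ⟨0, hx, (tendsto_inv₀_cobounded.comp hr).congr fun n => inv_div _ _⟩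

end Tame

section Cast

open Bornology

variable {α β γ : ℂ} {p q b : Fin 6 → ℂ}

/-- The mapping `(A * z + p, q, b)` with `A` affine and `p`, `q`, `b` of degree two in `x`, `y`. -/
def castMap (α β γ : ℂ) (p q b : Fin 6 → ℂ) : (Fin 3 → ℂ) → (Fin 3 → ℂ) :=
  mkMap (fun x y z => (α * x + β * y + γ) * z + quadFn p x y) (fun x y _ => quadFn q x y)
    (fun x y _ => quadFn b x y)

/-- The points whose last two coordinates are a value of `(q, b)` on the line `A = 0`. -/
def castLine (α β γ : ℂ) (q b : Fin 6 → ℂ) : Set (Fin 3 → ℂ) :=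
  {m | ∃ x y, α * x + β * y + γ = 0 ∧ m 1 = quadFn q x y ∧ m 2 = quadFn b x y}

theorem castLine_subset (h : α ≠ 0 ∨ β ≠ 0 ∨ γ ≠ 0) :
    castLine α β γ q b ⊆ asymptoticSet (castMap α β γ p q b) := by
  rintro m ⟨x₀, y₀, h0, h1, h2⟩
  obtain ⟨d, e, hde⟩ : ∃ d e : ℂ, α * d + β * e = 1 := by
    by_cases hα : α = 0
    · by_cases hβ : β = 0
      · simp_all
      · exact ⟨0, β⁻¹, by simp [hβ]⟩
    · exact ⟨α⁻¹, 0, by simp [hα]⟩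
  obtain ⟨a, ha⟩ : ∃ a, a = m 0 - quadFn p x₀ y₀ := ⟨_, rfl⟩
  refine mem_asymptoticSet_of_path (x := fun τ => x₀ + a * τ * d) (y := fun τ => y₀ + a * τ * e)
    (z := fun τ => τ⁻¹) (a := fun τ => a + quadFn p (x₀ + a * τ * d) (y₀ + a * τ * e))
    (b := fun τ => quadFn q (x₀ + a * τ * d) (y₀ + a * τ * e))
    (c := fun τ => quadFn b (x₀ + a * τ * d) (y₀ + a * τ * e))
    (Or.inr (Or.inr tendsto_inv_punctured)) (by unfold quadFn; fun_prop)
    (by unfold quadFn; fun_prop) (by unfold quadFn; fun_prop) ?_ (by simp [ha]) (by simp [h1])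
    (by simp [h2])
  filter_upwards [self_mem_nhdsWithin] with τ hτ
  have hτ : τ ≠ 0 := hτ
  refine ⟨?_, rfl, rfl⟩
  have : α * (x₀ + a * τ * d) + β * (y₀ + a * τ * e) + γ = a * τ := by
    linear_combination h0 + a * τ * hde
  rw [this]
  field_simp

theorem castMap_cases {m : Fin 3 → ℂ} (hm : m ∈ asymptoticSet (castMap α β γ p q b)) :
    m ∈ castLine α β γ q b ∨ ∃ (U : Ultrafilter ℕ) (x y : ℕ → ℂ),
      (∀ x₀ y₀, Tendsto x U (𝓝 x₀) → ¬ Tendsto y U (𝓝 y₀)) ∧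
      Tendsto (fun n => quadFn q (x n) (y n)) U (𝓝 (m 1)) ∧
      Tendsto (fun n => quadFn b (x n) (y n)) U (𝓝 (m 2)) := by
  obtain ⟨U, x, y, z, hU, hu, hv, hw⟩ := exists_ultrafilter_of_mem_asymptoticSet hm
  by_cases hxy : ∃ x₀ y₀, Tendsto x U (𝓝 x₀) ∧ Tendsto y U (𝓝 y₀)
  · left
    obtain ⟨x₀, y₀, hx, hy⟩ := hxy
    have hz : Tendsto z U (cobounded ℂ) :=
      (tendsto_nhds_or_cobounded U z).resolve_left fun ⟨z₀, hz⟩ => hU x₀ y₀ z₀ hx hy hz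
    refine ⟨x₀, y₀, ?_, tendsto_nhds_unique hv (tendsto_two (continuous_quadFn q) hx hy),
      tendsto_nhds_unique hw (tendsto_two (continuous_quadFn b) hx hy)⟩
    exact leadingCoeff_one hz ((tendsto_two (continuous_quadFn p) hx hy).sub hu)
      (((hx.const_mul α).add (hy.const_mul β)).add_const γ) (Eventually.of_forall fun n => by ring)
  · exact .inr ⟨U, x, y, fun x₀ y₀ hx hy => hxy ⟨x₀, y₀, hx, hy⟩, hv, hw⟩

theorem castLine_cases (h : α ≠ 0 ∨ β ≠ 0 ∨ γ ≠ 0) :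
    castLine α β γ q b = ∅ ∨ IsIrredZeroSet (castLine α β γ q b) ∨
      ∃ v w, castLine α β γ q b ⊆ {m | m 1 = v ∧ m 2 = w} ∧
        ∃ (U : Ultrafilter ℕ) (x y : ℕ → ℂ),
          (∀ x₀ y₀, Tendsto x U (𝓝 x₀) → ¬ Tendsto y U (𝓝 y₀)) ∧
          Tendsto (fun n => quadFn q (x n) (y n)) U (𝓝 v) ∧
          Tendsto (fun n => quadFn b (x n) (y n)) U (𝓝 w) := by
  by_cases hαβ : α = 0 ∧ β = 0
  · left
    refine Set.eq_empty_of_forall_notMem ?_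
    rintro m ⟨x, y, h0, -⟩
    simp_all
  right
  obtain ⟨x₀, y₀, hline⟩ : ∃ x₀ y₀, ∀ x y, α * x + β * y + γ = 0 ↔
      ∃ t, x = x₀ - β * t ∧ y = y₀ + α * t := by
    by_cases hα : α = 0
    · have hβ : β ≠ 0 := fun h => hαβ ⟨hα, h⟩
      refine ⟨0, -γ / β, fun x y => ⟨fun h => ⟨-x / β, ?_, ?_⟩, ?_⟩⟩
      · field_simp; ring
      · rw [hα] at h ⊢; field_simp; linear_combination h
      · rintro ⟨t, rfl, rfl⟩; rw [hα]; field_simp; ring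
    · refine ⟨-γ / α, 0, fun x y => ⟨fun h => ⟨y / α, ?_, ?_⟩, ?_⟩⟩
      · field_simp; linear_combination h
      · field_simp; ring
      · rintro ⟨t, rfl, rfl⟩; field_simp; ring
  have hquad : ∀ q : Fin 6 → ℂ, ∃ k₂ k₁ k₀, ∀ t,
      quadFn q (x₀ - β * t) (y₀ + α * t) = k₂ * t ^ 2 + k₁ * t + k₀ := fun q =>
    ⟨q 0 * β ^ 2 - q 1 * (β * α) + q 2 * α ^ 2,
      -2 * q 0 * x₀ * β + q 1 * (x₀ * α - β * y₀) + 2 * q 2 * y₀ * α - q 3 * β + q 4 * α,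
      quadFn q x₀ y₀, fun t => by unfold quadFn; ring⟩
  obtain ⟨h₂, h₁, h₀, hq⟩ := hquad q
  obtain ⟨k₂, k₁, k₀, hb⟩ := hquad b
  have hset : castLine α β γ q b =
      {m | ∃ t, m 1 = h₂ * t ^ 2 + h₁ * t + h₀ ∧ m 2 = k₂ * t ^ 2 + k₁ * t + k₀} := by
    ext m
    constructor
    · rintro ⟨x, y, h0, h1, h2⟩
      obtain ⟨t, rfl, rfl⟩ := (hline x y).mp h0
      exact ⟨t, by rw [h1, hq], by rw [h2, hb]⟩
    · rintro ⟨t, h1, h2⟩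
      exact ⟨_, _, (hline _ _).mpr ⟨t, rfl, rfl⟩, by rw [h1, hq], by rw [h2, hb]⟩
  by_cases hne : (h₁ ≠ 0 ∨ h₂ ≠ 0) ∨ (k₁ ≠ 0 ∨ k₂ ≠ 0)
  · left
    rw [hset]
    exact isIrredZeroSet_curve hne
  right
  push Not at hne
  obtain ⟨⟨rfl, rfl⟩, rfl, rfl⟩ := hne
  refine ⟨h₀, k₀, ?_, hyperfilter ℕ, fun n => x₀ - β * n, fun n => y₀ + α * n, ?_, ?_, ?_⟩
  · rw [hset]
    rintro m ⟨t, h1, h2⟩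
    exact ⟨by simpa using h1, by simpa using h2⟩
  · intro x₁ y₁ hx hy
    have hn : Tendsto (fun n : ℕ => (n : ℂ)) (hyperfilter ℕ) (cobounded ℂ) :=
      tendsto_natCast_atTop_cobounded.mono_left Nat.hyperfilter_le_atTop
    refine hαβ ⟨?_, ?_⟩
    · exact leadingCoeff_one hn (hy.const_sub y₀) tendsto_const_nhds
        (Eventually.of_forall fun n => by ring)
    · exact leadingCoeff_one hn (hx.sub_const x₀) tendsto_const_nhds
        (Eventually.of_forall fun n => by ring)
  · simp only [hq]; simp
  · simp only [hb]; simp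

end Cast

section CastTame

open Bornology

variable {α β γ : ℂ} {p q b : Fin 6 → ℂ}

theorem tendsto_quadFn_zero {U : Ultrafilter ℕ} {x y : ℕ → ℂ} {v : ℂ}
    (hy : Tendsto y U (cobounded ℂ)) (hs : Tendsto (fun n => x n / y n) U (𝓝 0))
    (hv : Tendsto (fun n => quadFn q (x n) (y n)) U (𝓝 v)) : q 2 = 0 := by
  have c2 := (((hs.pow 2).const_mul (q 0)).add (hs.const_mul (q 1))).add_const (q 2)
  have c1 := (hs.const_mul (q 3)).add_const (q 4)
  have c0 := hv.const_sub (q 5)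
  have := leadingCoeff_two hy c0 c1 c2 (by
    filter_upwards [hy.eventually_ne_cobounded 0] with n hn
    unfold quadFn
    field_simp
    ring)
  simpa using this

theorem exists_tendsto_of_mixed {U : Ultrafilter ℕ} {x y : ℕ → ℂ} {v : ℂ}
    (hy : Tendsto y U (cobounded ℂ)) (hs : Tendsto (fun n => x n / y n) U (𝓝 0))
    (hv : Tendsto (fun n => quadFn q (x n) (y n)) U (𝓝 v)) (hq : q 1 ≠ 0) :
    ∃ t, Tendsto x U (𝓝 t) := by
  refine (tendsto_nhds_or_cobounded U x).resolve_right fun hx => hq ?_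
  have h2 := tendsto_quadFn_zero hy hs hv
  have c1 := (hs.const_mul (q 0)).const_add (q 1)
  have c0 := ((hs.const_mul (q 3)).const_add (q 4)).add
    ((hv.const_sub (q 5)).mul (tendsto_inv₀_cobounded.comp hy))
  have := leadingCoeff_one hx c0 c1 (by
    filter_upwards [hy.eventually_ne_cobounded 0] with n hn
    simp only [Function.comp]
    unfold quadFn
    field_simp
    rw [h2]
    ring)
  simpa using this

theorem column_eq_of_tendsto (hb : b 1 = 0 ∧ b 2 = 0 ∧ b 4 = 0) (hne : b 3 ≠ 0 ∨ b 0 ≠ 0)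
    (hq : q 2 = 0) {U : Ultrafilter ℕ} {x y : ℕ → ℂ} {v w : ℂ}
    (hxy : ∀ x₀ y₀, Tendsto x U (𝓝 x₀) → ¬ Tendsto y U (𝓝 y₀))
    (hv : Tendsto (fun n => quadFn q (x n) (y n)) U (𝓝 v))
    (hw : Tendsto (fun n => quadFn b (x n) (y n)) U (𝓝 w)) :
    ∃ t, q 1 * t + q 4 = 0 ∧ w = b 0 * t ^ 2 + b 3 * t + b 5 := by
  obtain ⟨t, hx, ht⟩ := exists_tendsto_of_quadratic (x := x) (h₂ := b 0) (h₁ := b 3) (h₀ := b 5)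
    hne (hw.congr fun n => by
    unfold quadFn; rw [hb.1, hb.2.1, hb.2.2]; ring)
  have hy := (tendsto_nhds_or_cobounded U y).resolve_left fun ⟨y₀, hy⟩ => hxy t y₀ hx hy
  refine ⟨t, ?_, ht⟩
  exact leadingCoeff_one hy ((((hx.pow 2).const_mul (q 0)).add (hx.const_mul (q 3))).add
    (hv.const_sub (q 5))) ((hx.const_mul (q 1)).add_const (q 4)) (Eventually.of_forall fun n => by
      unfold quadFn; rw [hq]; ring)

theorem column_subset_asymptoticSet (h : α ≠ 0 ∨ β ≠ 0 ∨ γ ≠ 0)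
    (hb : b 1 = 0 ∧ b 2 = 0 ∧ b 4 = 0) (hq : q 2 = 0) (hq1 : q 1 ≠ 0) {t : ℂ}
    (ht : q 1 * t + q 4 = 0) :
    {m | m 2 = b 0 * t ^ 2 + b 3 * t + b 5} ⊆ asymptoticSet (castMap α β γ p q b) := by
  intro m hm
  rw [Set.mem_ofPred_eq] at hm
  obtain ⟨s, hs⟩ : ∃ s, q 1 * s + q 0 * t ^ 2 + q 3 * t + q 5 = m 1 :=
    ⟨(m 1 - (q 0 * t ^ 2 + q 3 * t + q 5)) / q 1, by field_simp; ring⟩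
  have hA : ∀ᶠ τ : ℂ in 𝓝[≠] 0, β + (α * t + γ) * τ + α * s * τ ^ 2 + α * τ ^ 3 ≠ 0 := by
    obtain ⟨c₁, hc₁⟩ : ∃ c, c = α * t + γ := ⟨_, rfl⟩
    obtain ⟨c₂, hc₂⟩ : ∃ c, c = α * s := ⟨_, rfl⟩
    rw [← hc₁, ← hc₂]
    obtain ⟨Q, hQ⟩ : ∃ Q : Polynomial ℂ, Q = Polynomial.C β + Polynomial.C c₁ * Polynomial.X +
      Polynomial.C c₂ * Polynomial.X ^ 2 + Polynomial.C α * Polynomial.X ^ 3 := ⟨_, rfl⟩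
    have hQ0 : Q ≠ 0 := by
      intro h0
      have e0 : Q.coeff 0 = 0 := by rw [h0]; simp
      have e1 : Q.coeff 1 = 0 := by rw [h0]; simp
      have e3 : Q.coeff 3 = 0 := by rw [h0]; simp
      simp [hQ, Polynomial.coeff_X, Polynomial.coeff_C, Polynomial.coeff_X_pow] at e0 e1 e3
      simp_all
    refine nhdsNE_le_cofinite 0 ?_
    rw [← compl_compl {τ : ℂ | β + c₁ * τ + c₂ * τ ^ 2 + α * τ ^ 3 ≠ 0}]
    refine Set.Finite.compl_mem_cofinite (Q.roots.toFinset.finite_toSet.subset fun τ hτ => ?_)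
    rw [Set.mem_compl_iff, Set.mem_ofPred_eq, not_not] at hτ
    simp only [Finset.mem_coe, Multiset.mem_toFinset, Polynomial.mem_roots hQ0, Polynomial.IsRoot]
    simpa [hQ] using hτ
  refine mem_asymptoticSet_of_path (x := fun τ => t + s * τ + τ ^ 2) (y := fun τ => τ⁻¹)
    (z := fun τ => (m 0 - quadFn p (t + s * τ + τ ^ 2) τ⁻¹) /
      (α * (t + s * τ + τ ^ 2) + β * τ⁻¹ + γ))
    (a := fun _ => m 0) (b := fun τ => q 1 * (s + τ) + q 0 * (t + s * τ + τ ^ 2) ^ 2 +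
      q 3 * (t + s * τ + τ ^ 2) + q 5)
    (c := fun τ => b 0 * (t + s * τ + τ ^ 2) ^ 2 + b 3 * (t + s * τ + τ ^ 2) + b 5)
    (Or.inr (Or.inl tendsto_inv_punctured)) (by fun_prop) (by fun_prop) (by fun_prop) ?_ rfl
    (by simp [← hs]) (by simp [hm])
  filter_upwards [self_mem_nhdsWithin, hA] with τ hτ hA
  have hτ : τ ≠ 0 := hτ
  have hA' : α * (t + s * τ + τ ^ 2) + β * τ⁻¹ + γ ≠ 0 := by
    have : α * (t + s * τ + τ ^ 2) + β * τ⁻¹ + γ =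
      (β + (α * t + γ) * τ + α * s * τ ^ 2 + α * τ ^ 3) / τ := by field_simp; ring
    rw [this]
    exact div_ne_zero hA hτ
  refine ⟨?_, ?_, ?_⟩
  · rw [mul_div_cancel₀ _ hA']; ring
  · unfold quadFn
    rw [hq]
    field_simp
    linear_combination τ * ht
  · unfold quadFn
    rw [hb.1, hb.2.1, hb.2.2]
    ring

theorem isTame_castMap_column (h : α ≠ 0 ∨ β ≠ 0 ∨ γ ≠ 0)
    (hb : b 1 = 0 ∧ b 2 = 0 ∧ b 4 = 0) (hq : q 2 = 0) {U : Ultrafilter ℕ} {x y : ℕ → ℂ} {v w : ℂ}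
    (hxy : ∀ x₀ y₀, Tendsto x U (𝓝 x₀) → ¬ Tendsto y U (𝓝 y₀))
    (hv : Tendsto (fun n => quadFn q (x n) (y n)) U (𝓝 v))
    (hw : Tendsto (fun n => quadFn b (x n) (y n)) U (𝓝 w)) :
    IsTame (castMap α β γ p q b) := by
  by_cases hne : b 3 ≠ 0 ∨ b 0 ≠ 0
  swap
  · push Not at hne
    refine .of_range_subset (isIrredZeroSet_horizontal (b 5)) ?_
    rintro _ ⟨r, rfl⟩
    simp [castMap, mkMap, quadFn, hb, hne]
  obtain ⟨t, ht, -⟩ := column_eq_of_tendsto hb hne hq hxy hv hw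
  by_cases hq1 : q 1 = 0
  · refine .of_range_subset (isIrredZeroSet_curve (h₂ := q 0) (h₁ := q 3) (h₀ := q 5) (k₀ := b 5)
      (.inr hne)) ?_
    have hq4 : q 4 = 0 := by simpa [hq1] using ht
    rintro _ ⟨r, rfl⟩
    exact ⟨r 0, by simp [castMap, mkMap, quadFn, hq, hq1, hq4],
      by simp [castMap, mkMap, quadFn, hb]⟩
  intro _
  have huniq : ∀ {U : Ultrafilter ℕ} {x y : ℕ → ℂ} {v w : ℂ},
      (∀ x₀ y₀, Tendsto x U (𝓝 x₀) → ¬ Tendsto y U (𝓝 y₀)) →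
      Tendsto (fun n => quadFn q (x n) (y n)) U (𝓝 v) →
      Tendsto (fun n => quadFn b (x n) (y n)) U (𝓝 w) → w = b 0 * t ^ 2 + b 3 * t + b 5 := by
    intro U x y v w hxy hv hw
    obtain ⟨t', ht', hw'⟩ := column_eq_of_tendsto hb hne hq hxy hv hw
    have : t' = t := mul_left_cancel₀ hq1 (by linear_combination ht' - ht)
    rw [hw', this]
  have hcol := column_subset_asymptoticSet (p := p) h hb hq hq1 ht
  have hcases : asymptoticSet (castMap α β γ p q b) =
      castLine α β γ q b ∪ {m | m 2 = b 0 * t ^ 2 + b 3 * t + b 5} := by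
    refine Set.Subset.antisymm (fun m hm => ?_) (Set.union_subset (castLine_subset h) hcol)
    rcases castMap_cases hm with hm | ⟨U, x, y, hxy, hv, hw⟩
    · exact .inl hm
    · exact .inr (huniq hxy hv hw)
  rcases castLine_cases (q := q) (b := b) h with hl | hl | ⟨v, w, hl, U, x, y, hxy, hv, hw⟩
  · exact .of_two (.inl hl) (.inr (isIrredZeroSet_horizontal _)) hcases
  · exact .of_two (.inr hl) (.inr (isIrredZeroSet_horizontal _)) hcases
  · refine .of_one (.inr ?_)
    rw [hcases, Set.union_eq_self_of_subset_left]
    · exact isIrredZeroSet_horizontal _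
    · intro m hm
      rw [Set.mem_ofPred_eq, (hl hm).2]
      exact huniq hxy hv hw

theorem isTame_castMap_combination {s t s' t' : ℂ} (hD : s * t' - t * s' ≠ 0)
    (H : IsTame (castMap α β γ p (s • q + t • b) (s' • q + t' • b))) :
    IsTame (castMap α β γ p q b) := by
  refine .of_target_change (M := !![1, 0, 0; 0, s, t; 0, s', t']) ?_ ?_ ?_ ?_ H
  · simpa [Matrix.det_fin_three] using hD
  · intro x y z; simp
  · intro x y z; simp [quadFn_combination]
  · intro x y z; simp [quadFn_combination]

theorem tendsto_combination {U : Ultrafilter ℕ} {x y : ℕ → ℂ} {v w : ℂ} (s t : ℂ)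
    (hv : Tendsto (fun n => quadFn q (x n) (y n)) U (𝓝 v))
    (hw : Tendsto (fun n => quadFn b (x n) (y n)) U (𝓝 w)) :
    Tendsto (fun n => quadFn (s • q + t • b) (x n) (y n)) U (𝓝 (s * v + t * w)) := by
  simp only [quadFn_combination]
  exact (hv.const_mul s).add (hw.const_mul t)

theorem isTame_castMap_of_vertical (h : α ≠ 0 ∨ β ≠ 0 ∨ γ ≠ 0) {U : Ultrafilter ℕ}
    {x y : ℕ → ℂ} {v w : ℂ} (hy : Tendsto y U (cobounded ℂ))
    (hs : Tendsto (fun n => x n / y n) U (𝓝 0))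
    (hv : Tendsto (fun n => quadFn q (x n) (y n)) U (𝓝 v))
    (hw : Tendsto (fun n => quadFn b (x n) (y n)) U (𝓝 w)) :
    IsTame (castMap α β γ p q b) := by
  have hxy : ∀ x₀ y₀, Tendsto x U (𝓝 x₀) → ¬ Tendsto y U (𝓝 y₀) := fun _ y₀ _ hy' =>
    hy'.not_tendsto (Metric.disjoint_nhds_cobounded y₀) hy
  -- the mixed coefficient of the last coordinate vanishes
  have key : ∀ {q b : Fin 6 → ℂ} {v w : ℂ}, b 1 = 0 → q 1 ≠ 0 →
      Tendsto (fun n => quadFn q (x n) (y n)) U (𝓝 v) →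
      Tendsto (fun n => quadFn b (x n) (y n)) U (𝓝 w) → IsTame (castMap α β γ p q b) := by
    intro q b v w hb1 hq1 hv hw
    have hb2 := tendsto_quadFn_zero hy hs hw
    obtain ⟨t, hx⟩ := exists_tendsto_of_mixed hy hs hv hq1
    have hb4 : b 4 = 0 := leadingCoeff_one hy ((((hx.pow 2).const_mul (b 0)).add
      (hx.const_mul (b 3))).add (hw.const_sub (b 5))) tendsto_const_nhds
      (Eventually.of_forall fun n => by unfold quadFn; rw [hb1, hb2]; ring)
    exact isTame_castMap_column h ⟨hb1, hb2, hb4⟩ (tendsto_quadFn_zero hy hs hv) hxy hv hw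
  by_cases hq1 : q 1 = 0
  · by_cases hb1 : b 1 = 0
    · by_cases hq4 : q 4 = 0
      · refine isTame_castMap_combination (s := 0) (t := 1) (s' := 1) (t' := 0) (by simp)
          (isTame_castMap_column h ?_ ?_ hxy (tendsto_combination 0 1 hv hw)
            (tendsto_combination 1 0 hv hw))
        · simp [hq1, hq4, tendsto_quadFn_zero hy hs hv]
        · simp [tendsto_quadFn_zero hy hs hw]
      · refine isTame_castMap_combination (s := 1) (t := 0) (s' := -(b 4 / q 4)) (t' := 1) (by simp)
          (isTame_castMap_column h ?_ ?_ hxy (tendsto_combination 1 0 hv hw)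
            (tendsto_combination _ 1 hv hw))
        · simp [hq1, hb1, hq4, tendsto_quadFn_zero hy hs hv, tendsto_quadFn_zero hy hs hw]
        · simp [tendsto_quadFn_zero hy hs hv]
    · refine isTame_castMap_combination (s := 0) (t := 1) (s' := 1) (t' := 0) (by simp)
        (key ?_ ?_ (tendsto_combination 0 1 hv hw) (tendsto_combination 1 0 hv hw))
      · simp [hq1]
      · simp [hb1]
  · refine isTame_castMap_combination (s := 1) (t := 0) (s' := -(b 1 / q 1)) (t' := 1) (by simp)
      (key ?_ ?_ (tendsto_combination 1 0 hv hw) (tendsto_combination _ 1 hv hw))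
    · simp [hq1]
    · simp [hq1]

theorem isTame_castMap (h : α ≠ 0 ∨ β ≠ 0 ∨ γ ≠ 0) : IsTame (castMap α β γ p q b) := by
  by_cases hU : ∃ (U : Ultrafilter ℕ) (x y : ℕ → ℂ) (v w : ℂ),
      (∀ x₀ y₀, Tendsto x U (𝓝 x₀) → ¬ Tendsto y U (𝓝 y₀)) ∧
      Tendsto (fun n => quadFn q (x n) (y n)) U (𝓝 v) ∧
      Tendsto (fun n => quadFn b (x n) (y n)) U (𝓝 w)
  · obtain ⟨U, x, y, v, w, hxy, hv, hw⟩ := hU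
    rcases ultrafilter_cases hxy with ⟨r, hx, hr⟩ | ⟨hy, hs⟩
    · obtain ⟨p', hp⟩ := exists_quadFn_affine p 0 1 0 1 r 0
      obtain ⟨q', hq⟩ := exists_quadFn_affine q 0 1 0 1 r 0
      obtain ⟨b', hb⟩ := exists_quadFn_affine b 0 1 0 1 r 0
      have hev : ∀ n, (0 * (y n - r * x n) + 1 * x n + 0 : ℂ) = x n ∧
          1 * (y n - r * x n) + r * x n + 0 = y n := fun n => ⟨by ring, by ring⟩
      have H : IsTame (castMap β (α + β * r) γ p' q' b') := by
        refine isTame_castMap_of_vertical (x := fun n => y n - r * x n) (y := x) (v := v) (w := w)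
          ?_ hx ?_ ?_ ?_
        · by_contra! h0
          obtain ⟨hβ, hα, hγ⟩ := h0
          rw [hβ, zero_mul, add_zero] at hα
          simp [hα, hβ, hγ] at h
        · have := hr.sub_const r
          rw [sub_self] at this
          refine this.congr' ?_
          filter_upwards [hx.eventually_ne_cobounded 0] with n hn
          field_simp
        · simpa only [hq, hev] using hv
        · simpa only [hb, hev] using hw
      refine IsTame.of_affine _ _ _ (α := 0) (β := 1) (γ := 0) (α' := 1) (β' := r) (γ' := 0)
        (by simp) ?_
      convert H using 1
      unfold castMap
      congr 1 <;> ext x y z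
      · rw [hp]; ring
      · rw [hq]
      · rw [hb]
    · exact isTame_castMap_of_vertical h hy hs hv hw
  · intro _
    refine .of_one ?_
    have : asymptoticSet (castMap α β γ p q b) = castLine α β γ q b := by
      refine Set.Subset.antisymm (fun m hm => ?_) (castLine_subset h)
      rcases castMap_cases hm with hm | ⟨U, x, y, hxy, hv, hw⟩
      · exact hm
      · exact absurd ⟨U, x, y, _, _, hxy, hv, hw⟩ hU
    rw [this]
    rcases castLine_cases (q := q) (b := b) h with hl | hl | ⟨v, w, -, U, x, y, hxy, hv, hw⟩
    · exact .inl hl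
    · exact .inr hl
    · exact absurd ⟨U, x, y, v, w, hxy, hv, hw⟩ hU

end CastTame

section Shear

open Bornology

variable {p q b : Fin 6 → ℂ}

/-- The mapping `(x * z + p, z + q, b)` with `p`, `q`, `b` of degree two in `x`, `y`. -/
def shearMap (p q b : Fin 6 → ℂ) : (Fin 3 → ℂ) → (Fin 3 → ℂ) :=
  mkMap (fun x y z => x * z + quadFn p x y) (fun x y z => z + quadFn q x y)
    (fun x y _ => quadFn b x y)

theorem shearMap_cases {m : Fin 3 → ℂ} (hm : m ∈ asymptoticSet (shearMap p q b)) :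
    ∃ (U : Ultrafilter ℕ) (x y u v : ℕ → ℂ),
      (∀ x₀ y₀, Tendsto x U (𝓝 x₀) → ¬ Tendsto y U (𝓝 y₀)) ∧
      Tendsto u U (𝓝 (m 0)) ∧ Tendsto v U (𝓝 (m 1)) ∧
      Tendsto (fun n => quadFn b (x n) (y n)) U (𝓝 (m 2)) ∧
      ∀ n, u n = quadFn p (x n) (y n) + x n * (v n - quadFn q (x n) (y n)) := by
  obtain ⟨U, x, y, z, hU, hu, hv, hw⟩ := exists_ultrafilter_of_mem_asymptoticSet hm
  refine ⟨U, x, y, _, _, fun x₀ y₀ hx hy => ?_, hu, hv, hw, fun n => by ring⟩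
  refine hU x₀ y₀ (m 1 - quadFn q x₀ y₀) hx hy ?_
  refine (hv.sub (tendsto_two (continuous_quadFn q) hx hy)).congr fun n => ?_
  ring

theorem mem_asymptoticSet_shearMap {x y u v w : ℂ → ℂ} {m : Fin 3 → ℂ}
    (hinf : Tendsto x (𝓝[≠] 0) (cobounded ℂ) ∨ Tendsto y (𝓝[≠] 0) (cobounded ℂ))
    (hu : ContinuousAt u 0) (hv : ContinuousAt v 0) (hw : ContinuousAt w 0)
    (heq : ∀ τ ≠ 0, u τ = quadFn p (x τ) (y τ) + x τ * (v τ - quadFn q (x τ) (y τ)) ∧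
      quadFn b (x τ) (y τ) = w τ)
    (hm0 : u 0 = m 0) (hm1 : v 0 = m 1) (hm2 : w 0 = m 2) :
    m ∈ asymptoticSet (shearMap p q b) := by
  refine mem_asymptoticSet_of_path (x := x) (y := y) (z := fun τ => v τ - quadFn q (x τ) (y τ))
    (a := u) (b := v) (c := w) (by tauto) hu hv hw ?_ hm0 hm1 hm2
  filter_upwards [self_mem_nhdsWithin] with τ hτ
  exact ⟨by rw [(heq τ hτ).1]; ring, by ring, (heq τ hτ).2⟩

theorem isUnionOfThree_shearMap_hyperbola (p q : Fin 6 → ℂ) (c : ℂ) :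
    IsUnionOfThree (asymptoticSet (shearMap p q ![0, 1, 0, 0, 0, c])) := by
  obtain ⟨T₁, hT₁⟩ : ∃ T : Set (Fin 3 → ℂ), T =
      {m | (q 0 = 0 ∧ p 0 - q 3 = 0) ∧ -q 1 * (m 2 - c) + (p 3 - q 5) + m 1 = 0} := ⟨_, rfl⟩
  obtain ⟨T₂, hT₂⟩ : ∃ T : Set (Fin 3 → ℂ), T =
      {m | p 2 = 0 ∧ -q 2 * (m 2 - c) + p 4 = 0 ∧
        (q 2 = 0 → (p 1 - q 4) * (m 2 - c) + p 5 - m 0 = 0)} := ⟨_, rfl⟩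
  refine .of_two (Z₁ := T₁) (Z₂ := T₂) ?_ ?_ (Set.Subset.antisymm ?_ (Set.union_subset ?_ ?_))
  · by_cases h : q 0 = 0 ∧ p 0 - q 3 = 0
    · right
      refine isIrredZeroSet_of_plane (a := 0) (b := 1) (c := -q 1) (d := q 1 * c + (p 3 - q 5))
        (by simp) fun m => ?_
      rw [hT₁]
      simp only [Set.mem_ofPred_eq, h, true_and, and_self]
      constructor <;> intro H <;> linear_combination H
    · left
      simp [hT₁, h]
  · by_cases h2 : p 2 = 0
    · by_cases hq : q 2 = 0
      · by_cases h4 : p 4 = 0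
        · right
          refine isIrredZeroSet_of_plane (a := -1) (b := 0) (c := p 1 - q 4)
            (d := p 5 - (p 1 - q 4) * c) (by simp) fun m => ?_
          rw [hT₂]
          simp only [Set.mem_ofPred_eq, h2, hq, h4, true_and, neg_zero, zero_mul, add_zero,
            forall_const]
          constructor <;> intro H <;> linear_combination H
        · left
          simp [hT₂, hq, h4]
      · right
        refine isIrredZeroSet_of_plane (a := 0) (b := 0) (c := -q 2) (d := q 2 * c + p 4)
          (by simp [hq]) fun m => ?_
        rw [hT₂]
        simp only [Set.mem_ofPred_eq, h2, hq, true_and, false_imp_iff, and_true]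
        constructor <;> intro H <;> linear_combination H
    · left
      simp [hT₂, h2]
  · intro m hm
    obtain ⟨U, x, y, u, v, hxy, hu, hv, hw, heq⟩ := shearMap_cases hm
    have hW : Tendsto (fun n => x n * y n) U (𝓝 (m 2 - c)) :=
      (hw.sub_const c).congr fun n => by simp [quadFn]
    rcases ultrafilter_cases hxy with ⟨-, hx, -⟩ | ⟨hy, -⟩
    · left
      have hy : Tendsto y U (𝓝 ((m 2 - c) * 0)) := by
        refine (hW.mul (tendsto_inv₀_cobounded.comp hx)).congr' ?_
        filter_upwards [hx.eventually_ne_cobounded 0] with n hn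
        simp only [Function.comp]
        field_simp
      rw [mul_zero] at hy
      have c1 := ((hW.const_mul (-q 1)).add_const (p 3 - q 5)).add hv
      have c0 := ((((((hW.mul hy).const_mul (-q 2)).add (hW.const_mul (p 1 - q 4))).add
        ((hy.pow 2).const_mul (p 2))).add (hy.const_mul (p 4))).add_const (p 5)).sub hu
      have e3 : -q 0 = 0 := leadingCoeff_three hx c0 c1 (tendsto_const_nhds (x := p 0 - q 3))
        tendsto_const_nhds (Eventually.of_forall fun n => by
          rw [heq n]; unfold quadFn; ring)
      have e3' : q 0 = 0 := by simpa using e3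
      have e2 : p 0 - q 3 = 0 := leadingCoeff_two hx c0 c1 tendsto_const_nhds
        (Eventually.of_forall fun n => by
          rw [heq n]; unfold quadFn; rw [e3']; ring)
      rw [hT₁]
      refine ⟨⟨e3', e2⟩, leadingCoeff_one hx c0 c1 (Eventually.of_forall fun n => ?_)⟩
      rw [heq n]; unfold quadFn; linear_combination x n ^ 3 * e3' - x n ^ 2 * e2
    · right
      have hx : Tendsto x U (𝓝 ((m 2 - c) * 0)) := by
        refine (hW.mul (tendsto_inv₀_cobounded.comp hy)).congr' ?_
        filter_upwards [hy.eventually_ne_cobounded 0] with n hn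
        simp only [Function.comp]
        field_simp
      rw [mul_zero] at hx
      have c1 := (hW.const_mul (-q 2)).add_const (p 4)
      have c0 := ((((((((hW.mul hx).const_mul (-q 1)).add ((hx.pow 3).const_mul (-q 0))).add
        (hW.const_mul (p 1 - q 4))).add ((hx.pow 2).const_mul (p 0 - q 3))).add
        (hx.const_mul (p 3 - q 5))).add (hv.mul hx)).add_const (p 5)).sub hu
      have e2 : p 2 = 0 := leadingCoeff_two hy c0 c1 tendsto_const_nhds
        (Eventually.of_forall fun n => by rw [heq n]; unfold quadFn; ring)
      have e1 := leadingCoeff_one hy c0 c1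
        (Eventually.of_forall fun n => by rw [heq n]; unfold quadFn; rw [e2]; ring)
      rw [hT₂]
      refine ⟨e2, e1, fun hq => ?_⟩
      have e4 : p 4 = 0 := by simpa [hq] using e1
      have := tendsto_nhds_unique (c0.congr fun n => by
        rw [heq n]; unfold quadFn; rw [e2, hq, e4]; ring) (tendsto_const_nhds (x := (0 : ℂ)))
      linear_combination this
  · rw [hT₁]
    rintro m ⟨⟨h0, h3⟩, hm⟩
    obtain ⟨W, hW⟩ : ∃ W, W = m 2 - c := ⟨_, rfl⟩
    obtain ⟨s, hs⟩ : ∃ s, s = m 0 - (p 1 - q 4) * W - p 5 := ⟨_, rfl⟩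
    refine mem_asymptoticSet_shearMap (x := fun τ => τ⁻¹) (y := fun τ => W * τ)
      (u := fun τ => m 0 + (p 4 * W - q 2 * W ^ 2) * τ + p 2 * W ^ 2 * τ ^ 2)
      (v := fun τ => m 1 + s * τ) (w := fun _ => m 2)
      (.inl tendsto_inv_punctured) (by fun_prop) (by fun_prop) (by fun_prop) (fun τ hτ => ⟨?_, ?_⟩)
      (by simp) (by simp) rfl
    · rw [← hW] at hm
      unfold quadFn
      field_simp
      linear_combination (-τ ^ 3) * hs - τ ^ 2 * hm + h0 - τ * h3
    · simp only [quadFn, hW, Matrix.cons_val]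
      field_simp
      ring
  · rw [hT₂]
    rintro m ⟨h2, h4, hm⟩
    obtain ⟨W, hW⟩ : ∃ W, W = m 2 - c := ⟨_, rfl⟩
    rw [← hW] at h4 hm
    obtain ⟨s, hs⟩ : ∃ s, -q 2 * s + (p 1 - q 4) * W + p 5 - m 0 = 0 := by
      by_cases hq : q 2 = 0
      · exact ⟨0, by linear_combination hm hq⟩
      · exact ⟨((p 1 - q 4) * W + p 5 - m 0) / q 2, by field_simp; ring⟩
    refine mem_asymptoticSet_shearMap (x := fun τ => (W + s * τ) * τ) (y := fun τ => τ⁻¹)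
      (u := fun τ => m 0 + (p 1 - q 4) * s * τ + (W + s * τ) * τ * (m 1 + p 3 - q 5
        - q 1 * (W + s * τ) + (p 0 - q 3) * ((W + s * τ) * τ) - q 0 * ((W + s * τ) * τ) ^ 2))
      (v := fun _ => m 1) (w := fun τ => W + s * τ + c)
      (.inr tendsto_inv_punctured) (by fun_prop) (by fun_prop) (by fun_prop) (fun τ hτ => ⟨?_, ?_⟩)
      (by simp) (by simp) (by simp [hW])
    · unfold quadFn
      rw [h2]
      field_simp
      linear_combination (-τ ^ 2) * hs - τ * h4
    · unfold quadFn
      simp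
      field_simp

theorem isUnionOfThree_shearMap_parabola (p q : Fin 6 → ℂ) (c : ℂ) :
    IsUnionOfThree (asymptoticSet (shearMap p q ![1, 0, 0, 0, 1, c])) := by
  obtain ⟨T, hT⟩ : ∃ T : Set (Fin 3 → ℂ), T =
      {m | (q 2 = 0 ∧ p 2 + q 1 = 0 ∧ p 1 - q 4 + q 0 = 0) ∧
        -2 * p 2 * (m 2 - c) - q 1 * (m 2 - c) + (p 0 - q 3) - p 4 = 0 ∧
        (p 2 = 0 → (p 1 - q 4) * (m 2 - c) + (p 3 - q 5) + m 1 = 0)} := ⟨_, rfl⟩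
  refine .of_one (S := asymptoticSet (shearMap p q ![1, 0, 0, 0, 1, c])) ?_
  rw [show asymptoticSet (shearMap p q ![1, 0, 0, 0, 1, c]) = T from
    Set.Subset.antisymm ?_ ?_]
  · by_cases h : q 2 = 0 ∧ p 2 + q 1 = 0 ∧ p 1 - q 4 + q 0 = 0
    · by_cases h2 : p 2 = 0
      · have h1 : q 1 = 0 := by linear_combination h.2.1 - h2
        by_cases h3 : (p 0 - q 3) - p 4 = 0
        · right
          refine isIrredZeroSet_of_plane (a := 0) (b := 1) (c := p 1 - q 4)
            (d := p 3 - q 5 - (p 1 - q 4) * c) (by simp) fun m => ?_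
          rw [hT]
          simp only [Set.mem_ofPred_eq, h, h2, h1, h3, true_and, and_self, mul_zero, zero_mul,
            sub_self, zero_add, forall_const]
          constructor <;> intro H <;> linear_combination H
        · left
          simp [hT, h2, h1, h3]
      · right
        refine isIrredZeroSet_of_plane (a := 0) (b := 0) (c := -p 2)
            (d := p 2 * c + (p 0 - q 3) - p 4) (by simp [h2]) fun m => ?_
        rw [hT]
        simp only [Set.mem_ofPred_eq, h2, h, true_and, and_self, false_imp_iff, and_true]
        constructor <;> intro H
        · linear_combination H + (m 2 - c) * h.2.1
        · linear_combination H - (m 2 - c) * h.2.1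
    · left
      simp [hT, h]
  · intro m hm
    obtain ⟨U, x, y, u, v, hxy, hu, hv, hw, heq⟩ := shearMap_cases hm
    obtain ⟨W, hW'⟩ : ∃ W : ℕ → ℂ, ∀ n, W n = x n ^ 2 + y n := ⟨_, fun _ => rfl⟩
    have hW : Tendsto W U (𝓝 (m 2 - c)) :=
      (hw.sub_const c).congr fun n => by simp [quadFn, hW']
    have hy' : ∀ n, y n = W n - x n ^ 2 := fun n => by rw [hW']; ring
    have hx : Tendsto x U (cobounded ℂ) := by
      refine (tendsto_nhds_or_cobounded U x).resolve_left fun ⟨x₀, hx⟩ => ?_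
      exact hxy _ _ hx ((hW.sub (hx.pow 2)).congr fun n => (hy' n).symm)
    have c1 := ((((hW.pow 2).const_mul (-q 2)).add (hW.const_mul (p 1 - q 4))).add_const
      (p 3 - q 5)).add hv
    have c0 := ((((hW.pow 2).const_mul (p 2)).add (hW.const_mul (p 4))).add_const (p 5)).sub hu
    have c2 := (((hW.const_mul (-2 * p 2)).sub (hW.const_mul (q 1))).add_const
      (p 0 - q 3)).sub_const (p 4)
    have c3 := (hW.const_mul (2 * q 2)).sub_const (p 1 - q 4 + q 0)
    have e5 : -q 2 = 0 := leadingCoeff_five hx c0 c1 c2 c3 (tendsto_const_nhds (x := p 2 + q 1))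
      tendsto_const_nhds (Eventually.of_forall fun n => by
        rw [heq n]; unfold quadFn; rw [hy']; ring)
    have e5' : q 2 = 0 := by simpa using e5
    have e4 : p 2 + q 1 = 0 := leadingCoeff_four hx c0 c1 c2 c3 tendsto_const_nhds
      (Eventually.of_forall fun n => by
        rw [heq n]; unfold quadFn; rw [hy', e5']; ring)
    have e3 := leadingCoeff_three hx c0 c1 c2 c3 (Eventually.of_forall fun n => by
        rw [heq n]; unfold quadFn; rw [hy', e5']; linear_combination -x n ^ 4 * e4)
    have e3' : p 1 - q 4 + q 0 = 0 := by
      rw [e5'] at e3; linear_combination -e3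
    have e2 := leadingCoeff_two hx c0 c1 c2 (Eventually.of_forall fun n => by
        rw [heq n]; unfold quadFn; rw [hy', e5']
        linear_combination -x n ^ 4 * e4 + x n ^ 3 * e3')
    rw [hT]
    refine ⟨⟨e5', e4, e3'⟩, e2, fun h2 => ?_⟩
    have h1 : q 1 = 0 := by linear_combination e4 - h2
    have h0 : (p 0 - q 3) - p 4 = 0 := by rw [h2, h1] at e2; linear_combination e2
    have e1 := leadingCoeff_one hx c0 c1 (Eventually.of_forall fun n => by
        rw [heq n]; unfold quadFn; rw [hy', e5', h2, h1]
        linear_combination x n ^ 3 * e3' - x n ^ 2 * h0)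
    rw [e5'] at e1
    linear_combination e1
  · rw [hT]
    rintro m ⟨⟨h5, h4, h3⟩, h2, h1⟩
    obtain ⟨W, hW⟩ : ∃ W, W = m 2 - c := ⟨_, rfl⟩
    rw [← hW] at h2 h1
    obtain ⟨r, hr⟩ : ∃ r, -p 2 * r + (p 1 - q 4) * W + (p 3 - q 5) + m 1 = 0 := by
      by_cases hp : p 2 = 0
      · exact ⟨0, by linear_combination h1 hp⟩
      · exact ⟨((p 1 - q 4) * W + (p 3 - q 5) + m 1) / p 2, by field_simp; ring⟩
    obtain ⟨s, hs⟩ : ∃ s, s = m 0 - (p 1 - q 4) * r - p 2 * W ^ 2 - p 4 * W - p 5 := ⟨_, rfl⟩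
    refine mem_asymptoticSet_shearMap (x := fun τ => τ⁻¹) (y := fun τ => W + r * τ - (τ⁻¹) ^ 2)
      (u := fun τ => m 0 + (2 * p 2 * W * r + p 4 * r) * τ + p 2 * r ^ 2 * τ ^ 2)
      (v := fun τ => m 1 + s * τ) (w := fun τ => W + r * τ + c)
      (.inl tendsto_inv_punctured) (by fun_prop) (by fun_prop) (by fun_prop) (fun τ hτ => ⟨?_, ?_⟩)
      (by simp) (by simp) (by simp [hW])
    · have e1 : q 1 = -p 2 := by linear_combination h4
      have e0 : q 0 = q 4 - p 1 := by linear_combination h3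
      have f4 : p 4 = -p 2 * W + (p 0 - q 3) := by linear_combination -h2 - W * h4
      have m1 : m 1 = p 2 * r - (p 1 - q 4) * W - (p 3 - q 5) := by linear_combination hr
      have m0 : m 0 = s + (p 1 - q 4) * r + p 2 * W ^ 2 + p 4 * W + p 5 := by
        linear_combination -hs
      unfold quadFn
      rw [m0, m1, h5, e1, e0, f4]
      field_simp
      ring
    · simp only [quadFn, Matrix.cons_val]
      field_simp
      ring

theorem isUnionOfThree_shearMap_column (hq : q 2 ≠ 0) (hb : b 1 = 0 ∧ b 2 = 0 ∧ b 4 = 0)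
    (hne : b 3 ≠ 0 ∨ b 0 ≠ 0) : IsUnionOfThree (asymptoticSet (shearMap p q b)) := by
  obtain ⟨t, ht⟩ : ∃ t, -q 2 * t + p 2 = 0 := ⟨p 2 / q 2, by field_simp; ring⟩
  have hS : asymptoticSet (shearMap p q b) = {m | m 2 = b 0 * t ^ 2 + b 3 * t + b 5} := by
    refine Set.Subset.antisymm (fun m hm => ?_) (fun m hm => ?_)
    · obtain ⟨U, x, y, u, v, hxy, hu, hv, hw, heq⟩ := shearMap_cases hm
      obtain ⟨t', hx, ht'⟩ := exists_tendsto_of_quadratic (x := x) (h₂ := b 0) (h₁ := b 3)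
        (h₀ := b 5) hne (hw.congr fun n => by
          unfold quadFn; rw [hb.1, hb.2.1, hb.2.2]; ring)
      have hy := (tendsto_nhds_or_cobounded U y).resolve_left fun ⟨y₀, hy⟩ => hxy t' y₀ hx hy
      have e2 := leadingCoeff_two hy
        (((((((hx.pow 3).const_mul (-q 0)).add ((hx.pow 2).const_mul (p 0 - q 3))).add
        (hx.const_mul (p 3 - q 5))).add (hv.mul hx)).add_const (p 5)).sub hu)
        ((((hx.pow 2).const_mul (-q 1)).add (hx.const_mul (p 1 - q 4))).add_const (p 4))
        ((hx.const_mul (-q 2)).add_const (p 2))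
        (Eventually.of_forall fun n => by rw [heq n]; unfold quadFn; ring)
      have : t' = t := mul_left_cancel₀ hq (by linear_combination ht - e2)
      rw [Set.mem_ofPred_eq, ht', this]
    · rw [Set.mem_ofPred_eq] at hm
      obtain ⟨s, hs⟩ : ∃ s, -q 2 * s - q 1 * t ^ 2 + (p 1 - q 4) * t + p 4 = 0 :=
        ⟨(-q 1 * t ^ 2 + (p 1 - q 4) * t + p 4) / q 2, by field_simp; ring⟩
      obtain ⟨r, hr⟩ : ∃ r, -q 2 * r - 2 * q 1 * t * s + (p 1 - q 4) * s - q 0 * t ^ 3 +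
          (p 0 - q 3) * t ^ 2 + (p 3 - q 5) * t + m 1 * t + p 5 = m 0 :=
        ⟨(- 2 * q 1 * t * s + (p 1 - q 4) * s - q 0 * t ^ 3 +
          (p 0 - q 3) * t ^ 2 + (p 3 - q 5) * t + m 1 * t + p 5 - m 0) / q 2, by field_simp; ring⟩
      refine mem_asymptoticSet_shearMap (x := fun τ => t + s * τ + r * τ ^ 2) (y := fun τ => τ⁻¹)
        (u := fun τ => m 0 - q 1 * (s ^ 2 + 2 * t * r + 2 * s * r * τ + r ^ 2 * τ ^ 2) * τ +
          (p 1 - q 4) * r * τ - q 0 * ((t + s * τ + r * τ ^ 2) ^ 3 - t ^ 3) +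
          (p 0 - q 3) * ((t + s * τ + r * τ ^ 2) ^ 2 - t ^ 2) +
          (p 3 - q 5 + m 1) * (s * τ + r * τ ^ 2))
        (v := fun _ => m 1)
        (w := fun τ => b 0 * (t + s * τ + r * τ ^ 2) ^ 2 + b 3 * (t + s * τ + r * τ ^ 2) + b 5)
        (.inr tendsto_inv_punctured) (by fun_prop) (by fun_prop) (by fun_prop)
        (fun τ hτ => ⟨?_, ?_⟩) (by simp) rfl (by simp [hm])
      · unfold quadFn
        rw [← hr]
        field_simp
        linear_combination (-1) * ht - τ * hs
      · unfold quadFn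
        rw [hb.1, hb.2.1, hb.2.2]
        ring
  rw [hS]
  exact .of_one (.inr (isIrredZeroSet_horizontal _))

theorem isTame_shearMap_of_normal {d α β γ κ : ℂ} (hβ : β ≠ 0) (hκ : κ ≠ 0) {b' : Fin 6 → ℂ}
    (hb : ∀ x y, quadFn b' x y = κ * quadFn b (x - d) (α * x + β * y + γ))
    (H : ∀ p q, IsUnionOfThree (asymptoticSet (shearMap p q b'))) :
    IsTame (shearMap p q b) := by
  intro _
  obtain ⟨p', hp⟩ := exists_quadFn_affine (p + d • q) 1 0 (-d) α β γ
  obtain ⟨q', hq⟩ := exists_quadFn_affine q 1 0 (-d) α β γ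
  have hpq : ∀ x y, quadFn (p + d • q) x y = quadFn p x y + d * quadFn q x y := fun x y => by
    simpa using quadFn_combination 1 d p q x y
  unfold shearMap
  rw [← asymptoticSet_mkMap_affine _ _ _ (α := 1) (β := 0) (γ := -d) (α' := α) (β' := β) (γ' := γ)
    (by simpa using hβ)]
  have hx : ∀ x y : ℂ, 1 * x + 0 * y + -d = x - d := fun x y => by ring
  refine .of_target_change (M := !![1, d, 0; 0, 1, 0; 0, 0, κ]) ?_ ?_ ?_ ?_ (H p' q')
  · simpa [Matrix.det_fin_three] using hκ
  · intro x y z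
    simp [hp, hpq]
    ring
  · intro x y z; simp [hq]
  · intro x y z; rw [hb, ← hx x y]; simp

theorem isTame_shearMap {U : Ultrafilter ℕ} {x y z : ℕ → ℂ} {u v w : ℂ}
    (hz : Tendsto z U (cobounded ℂ)) (hxz : Tendsto (fun n => x n / z n) U (𝓝 0))
    (hyz : Tendsto (fun n => y n / z n) U (𝓝 0))
    (hu : Tendsto (fun n => x n * z n + quadFn p (x n) (y n)) U (𝓝 u))
    (hv : Tendsto (fun n => z n + quadFn q (x n) (y n)) U (𝓝 v))
    (hw : Tendsto (fun n => quadFn b (x n) (y n)) U (𝓝 w)) : IsTame (shearMap p q b) := by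
  have hxy : ∀ x₀ y₀, Tendsto x U (𝓝 x₀) → ¬ Tendsto y U (𝓝 y₀) := by
    intro x₀ y₀ hx hy
    refine hz.not_tendsto (Metric.disjoint_nhds_cobounded (v - quadFn q x₀ y₀)).symm ?_
    refine (hv.sub (tendsto_two (continuous_quadFn q) hx hy)).congr fun n => ?_
    ring
  rcases ultrafilter_cases hxy with ⟨r, hx, hr⟩ | ⟨hy, hr⟩
  · have hxi : Tendsto (fun n => (x n)⁻¹) U (𝓝 0) := tendsto_inv₀_cobounded.comp hx
    have := leadingCoeff_one hz
      ((((hr.const_mul (p 4)).const_add (p 3)).add (hxi.const_mul (p 5))).sub (hu.mul hxi))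
      (((((hr.const_mul (p 1)).const_add (p 0)).add ((hr.pow 2).const_mul (p 2))).mul hxz).const_add
        1) (by
        filter_upwards [hx.eventually_ne_cobounded 0, hz.eventually_ne_cobounded 0] with n hn hn'
        unfold quadFn
        field_simp
        ring)
    simp at this
  have hb2 := tendsto_quadFn_zero hy hr hw
  by_cases hb1 : b 1 = 0
  swap
  · refine isTame_shearMap_of_normal (d := b 4 / b 1) (α := -b 0 / b 1) (β := (b 1)⁻¹)
      (γ := -(b 3 - 2 * b 0 * (b 4 / b 1)) / b 1) (κ := 1) (inv_ne_zero hb1) one_ne_zero ?_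
      fun p q => isUnionOfThree_shearMap_hyperbola p q
        (b 0 * (b 4 / b 1) ^ 2 - b 3 * (b 4 / b 1) + b 5)
    intro x y
    simp only [quadFn, Matrix.cons_val]
    rw [hb2]
    field_simp
    ring
  by_cases hb4 : b 4 = 0
  swap
  · have hb0 : b 0 ≠ 0 := by
      intro hb0
      have := leadingCoeff_one hy (hw.const_sub (b 5))
        ((hr.const_mul (b 3)).const_add (b 4)) (by
          filter_upwards [hy.eventually_ne_cobounded 0] with n hn
          unfold quadFn
          rw [hb0, hb1, hb2]
          field_simp
          ring)
      exact hb4 (by simpa using this)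
    refine isTame_shearMap_of_normal (d := 0) (α := -b 3 / b 4) (β := b 0 / b 4)
      (γ := 0) (κ := (b 0)⁻¹) (div_ne_zero hb0 hb4) (inv_ne_zero hb0) ?_
      fun p q => isUnionOfThree_shearMap_parabola p q (b 5 / b 0)
    intro x y
    simp only [quadFn, Matrix.cons_val]
    rw [hb2, hb1]
    field_simp
    ring
  by_cases hne : b 3 ≠ 0 ∨ b 0 ≠ 0
  swap
  · push Not at hne
    refine .of_range_subset (isIrredZeroSet_horizontal (b 5)) ?_
    rintro _ ⟨r, rfl⟩
    simp [shearMap, mkMap, quadFn, hb1, hb2, hb4, hne]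
  refine fun _ => isUnionOfThree_shearMap_column (fun hq => ?_) ⟨hb1, hb2, hb4⟩ hne
  obtain ⟨t, hx, -⟩ := exists_tendsto_of_quadratic (x := x) (h₂ := b 0) (h₁ := b 3)
    (h₀ := b 5) hne (hw.congr fun n => by
      unfold quadFn; rw [hb1, hb2, hb4]; ring)
  have := leadingCoeff_one hz
    ((((hx.pow 2).const_mul (q 0)).add (hx.const_mul (q 3))).add (hv.const_sub (q 5)))
    ((((hx.const_mul (q 1)).add_const (q 4)).mul hyz).const_add 1) (by
      filter_upwards [hz.eventually_ne_cobounded 0] with n hn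
      unfold quadFn
      rw [hq]
      field_simp
      ring)
  simp at this

end Shear

section Assembly

open Bornology

variable {A : Matrix (Fin 3) (Fin 3) ℂ} {P : Matrix (Fin 3) (Fin 6) ℂ}

theorem isTame_pencilMap (p q b : Fin 6 → ℂ) : IsTame (pencilMap p q (quadFn b)) := by
  by_cases hb : ∃ x y, quadFn b x y ≠ b 5
  · exact fun _ => isGoodPencil_quadFn hb p q
  · push Not at hb
    refine .of_range_subset (isIrredZeroSet_horizontal (b 5)) ?_
    rintro _ ⟨r, rfl⟩
    exact hb _ _

/-- The mapping of degree two in three variables, of degree at most one in the last variable,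
whose linear coefficients in the last variable are given by `A` and whose remaining part is given
by `P`. -/
def affMap (A : Matrix (Fin 3) (Fin 3) ℂ) (P : Matrix (Fin 3) (Fin 6) ℂ) :
    (Fin 3 → ℂ) → (Fin 3 → ℂ) :=
  fun v i => (A i 0 * v 0 + A i 1 * v 1 + A i 2) * v 2 + quadFn (P i) (v 0) (v 1)

/-- Some values of `affMap A P` converge along points escaping in the direction of the last
coordinate. -/
def EscapesVertically (A : Matrix (Fin 3) (Fin 3) ℂ) (P : Matrix (Fin 3) (Fin 6) ℂ) : Prop :=
  ∃ (U : Ultrafilter ℕ) (x y z : ℕ → ℂ) (m : Fin 3 → ℂ), Tendsto z U (cobounded ℂ) ∧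
    Tendsto (fun n => x n / z n) U (𝓝 0) ∧ Tendsto (fun n => y n / z n) U (𝓝 0) ∧
    Tendsto (fun n => affMap A P ![x n, y n, z n]) U (𝓝 m)

theorem mulVec_affMap (M : Matrix (Fin 3) (Fin 3) ℂ) (v : Fin 3 → ℂ) :
    M.mulVec (affMap A P v) = affMap (M * A) (M * P) v := by
  ext i
  simp only [affMap, quadFn, Matrix.mulVec, dotProduct, Matrix.mul_apply, Fin.sum_univ_three]
  ring

theorem EscapesVertically.mul (h : EscapesVertically A P) (M : Matrix (Fin 3) (Fin 3) ℂ) :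
    EscapesVertically (M * A) (M * P) := by
  obtain ⟨U, x, y, z, m, hz, hx, hy, hm⟩ := h
  refine ⟨U, x, y, z, M.mulVec m, hz, hx, hy, ?_⟩
  simp only [← mulVec_affMap]
  exact ((Continuous.matrix_mulVec continuous_const continuous_id).tendsto m).comp hm

theorem isTame_affMap_of_mul {M : Matrix (Fin 3) (Fin 3) ℂ} (hM : M.det ≠ 0)
    (H : IsTame (affMap (M * A) (M * P))) : IsTame (affMap A P) := by
  refine .of_mulVec hM ?_
  simpa only [mulVec_affMap] using H

theorem affMap_eq_mkMap : affMap A P =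
    mkMap (fun x y z => (A 0 0 * x + A 0 1 * y + A 0 2) * z + quadFn (P 0) x y)
      (fun x y z => (A 1 0 * x + A 1 1 * y + A 1 2) * z + quadFn (P 1) x y)
      (fun x y z => (A 2 0 * x + A 2 1 * y + A 2 2) * z + quadFn (P 2) x y) := by
  ext v i
  fin_cases i <;> rfl

theorem isTame_affMap_of_constant (h1 : A 1 = 0) (h2 : A 2 = 0) : IsTame (affMap A P) := by
  by_cases h0 : A 0 = 0
  · intro hd
    exfalso
    refine not_dense_range_of_two_variables (fun i => MvPolynomial.C (P i 0) * MvPolynomial.X 0 ^ 2 +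
      MvPolynomial.C (P i 1) * (MvPolynomial.X 0 * MvPolynomial.X 1) +
      MvPolynomial.C (P i 2) * MvPolynomial.X 1 ^ 2 + MvPolynomial.C (P i 3) * MvPolynomial.X 0 +
      MvPolynomial.C (P i 4) * MvPolynomial.X 1 + MvPolynomial.C (P i 5)) _
      (fun v => ![v 0, v 1]) (fun v i => ?_) hd
    have hA : A = 0 := by
      ext i j
      fin_cases i
      · exact congrFun h0 j
      · exact congrFun h1 j
      · exact congrFun h2 j
    simp [affMap, quadFn, hA]
  · have : affMap A P = castMap (A 0 0) (A 0 1) (A 0 2) (P 0) (P 1) (P 2) := by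
      rw [affMap_eq_mkMap, castMap]
      simp [h1, h2]
    rw [this]
    refine isTame_castMap ?_
    by_contra! h
    refine h0 (funext fun j => ?_)
    fin_cases j
    · exact h.1
    · exact h.2.1
    · exact h.2.2

theorem isTame_affMap_of_shear (h10 : A 1 0 = 0) (h11 : A 1 1 = 0) (h12 : A 1 2 ≠ 0)
    (h2 : A 2 = 0) (h0 : A 0 0 ≠ 0 ∨ A 0 1 ≠ 0) (h : EscapesVertically A P) :
    IsTame (affMap A P) := by
  obtain ⟨U, x, y, z, m, hz, hx, hy, hm⟩ := h
  obtain ⟨d₀, d₁, hD⟩ : ∃ d₀ d₁, A 0 0 * d₁ - A 0 1 * d₀ ≠ 0 := by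
    rcases h0 with h | h
    · exact ⟨0, 1, by simpa using h⟩
    · exact ⟨1, 0, by simpa using h⟩
  obtain ⟨D, hD'⟩ : ∃ D, D = A 0 0 * d₁ - A 0 1 * d₀ := ⟨_, rfl⟩
  rw [← hD'] at hD
  have hex : ∀ p : Fin 6 → ℂ, ∃ p', ∀ x y, quadFn p' x y = quadFn p
      (d₁ / D * x + -A 0 1 / D * y + -(d₁ * A 0 2) / D)
      (-d₀ / D * x + A 0 0 / D * y + d₀ * A 0 2 / D) := fun p => exists_quadFn_affine p _ _ _ _ _ _
  have hinv : ∀ x y, d₁ / D * (A 0 0 * x + A 0 1 * y + A 0 2) + -A 0 1 / D * (d₀ * x + d₁ * y) +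
      -(d₁ * A 0 2) / D = x ∧ -d₀ / D * (A 0 0 * x + A 0 1 * y + A 0 2) +
      A 0 0 / D * (d₀ * x + d₁ * y) + d₀ * A 0 2 / D = y := by
    intro x y
    constructor
    · field_simp; rw [hD']; ring
    · field_simp; rw [hD']; ring
  obtain ⟨p, hp⟩ := hex (P 0)
  obtain ⟨q, hq⟩ := hex ((A 1 2)⁻¹ • P 1 + (0 : ℂ) • P 1)
  obtain ⟨b, hb⟩ := hex (P 2)
  have hq' : ∀ x y, quadFn q x y = (A 1 2)⁻¹ * quadFn (P 1)
      (d₁ / D * x + -A 0 1 / D * y + -(d₁ * A 0 2) / D)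
      (-d₀ / D * x + A 0 0 / D * y + d₀ * A 0 2 / D) := fun x y => by
    rw [hq, quadFn_combination]; ring
  have hzi : Tendsto (fun n => (z n)⁻¹) U (𝓝 0) := tendsto_inv₀_cobounded.comp hz
  have hm' := tendsto_pi_nhds.mp hm
  have H : IsTame (shearMap p q b) := by
    refine isTame_shearMap (x := fun n => A 0 0 * x n + A 0 1 * y n + A 0 2)
      (y := fun n => d₀ * x n + d₁ * y n) (z := z) (u := m 0) (v := (A 1 2)⁻¹ * m 1) (w := m 2)
      hz ?_ ?_ ?_ ?_ ?_
    · have := ((hx.const_mul (A 0 0)).add (hy.const_mul (A 0 1))).add (hzi.const_mul (A 0 2))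
      simp only [mul_zero, add_zero] at this
      exact this.congr fun n => by ring
    · have := (hx.const_mul d₀).add (hy.const_mul d₁)
      simp only [mul_zero, add_zero] at this
      exact this.congr fun n => by ring
    · simpa [hp, hinv, affMap] using hm' 0
    · refine ((hm' 1).const_mul (A 1 2)⁻¹).congr fun n => ?_
      simp only [hq', hinv]
      simp [affMap, h10, h11]
      field_simp
    · simpa [hb, hinv, affMap, h2] using hm' 2
  rw [affMap_eq_mkMap]
  refine IsTame.of_affine _ _ _ (α := d₁ / D) (β := -A 0 1 / D) (γ := -(d₁ * A 0 2) / D)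
    (α' := -d₀ / D) (β' := A 0 0 / D) (γ' := d₀ * A 0 2 / D) ?_ ?_
  · have : d₁ / D * (A 0 0 / D) - -A 0 1 / D * (-d₀ / D) = D⁻¹ := by
      field_simp; rw [hD']; ring
    rw [this]
    exact inv_ne_zero hD
  · refine IsTame.of_target_change (M := !![1, 0, 0; 0, (A 1 2)⁻¹, 0; 0, 0, 1]) ?_ ?_ ?_ ?_ H
    · simpa [Matrix.det_fin_three] using h12
    · intro x y z
      simp only [Matrix.of_apply, Matrix.cons_val', Matrix.cons_val, hp]
      field_simp
      rw [hD']
      ring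
    · intro x y z
      simp [hq', h10, h11]
      field_simp
    · intro x y z
      simp [hb, h2]

theorem isTame_affMap_of_dependent (h10 : A 1 0 = 0) (h11 : A 1 1 = 0) (h2 : A 2 = 0)
    (h : EscapesVertically A P) : IsTame (affMap A P) := by
  by_cases h12 : A 1 2 = 0
  · refine isTame_affMap_of_constant (funext fun j => ?_) h2
    fin_cases j
    · exact h10
    · exact h11
    · exact h12
  by_cases h0 : A 0 0 ≠ 0 ∨ A 0 1 ≠ 0
  · exact isTame_affMap_of_shear h10 h11 h12 h2 h0 h
  · push Not at h0
    refine isTame_affMap_of_mul (M := !![0, 1, 0; 1, -(A 0 2 / A 1 2), 0; 0, 0, 1])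
      (by simp [Matrix.det_fin_three]) (isTame_affMap_of_constant ?_ ?_)
    · ext j
      fin_cases j <;> simp [Matrix.mul_apply, Fin.sum_univ_three, h0, h10, h11, h12]
    · ext j
      simp [Matrix.mul_apply, Fin.sum_univ_three, h2]

theorem isTame_affMap_of_row (h2 : A 2 = 0) (h : EscapesVertically A P) : IsTame (affMap A P) := by
  by_cases hD : A 0 0 * A 1 1 - A 0 1 * A 1 0 = 0
  · obtain ⟨s, t, hst, e0, e1⟩ : ∃ s t, (s ≠ 0 ∨ t ≠ 0) ∧ s * A 0 0 + t * A 1 0 = 0 ∧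
        s * A 0 1 + t * A 1 1 = 0 := by
      by_cases h0 : A 0 0 = 0 ∧ A 0 1 = 0
      · exact ⟨1, 0, by simp, by simp [h0], by simp [h0]⟩
      · by_cases h00 : A 0 0 = 0
        · refine ⟨A 1 1, -A 0 1, .inr ?_, ?_, by ring⟩
          · exact neg_ne_zero.mpr fun h => h0 ⟨h00, h⟩
          · linear_combination hD
        · exact ⟨A 1 0, -A 0 0, .inr (neg_ne_zero.mpr h00), by ring, by linear_combination -hD⟩
    rcases hst with hs | ht
    · refine isTame_affMap_of_mul (M := !![0, 1, 0; s, t, 0; 0, 0, 1])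
        (by simpa [Matrix.det_fin_three] using hs) (isTame_affMap_of_dependent ?_ ?_ ?_ (h.mul _))
      · simpa [Matrix.mul_apply, Fin.sum_univ_three] using e0
      · simpa [Matrix.mul_apply, Fin.sum_univ_three] using e1
      · ext j; simp [Matrix.mul_apply, Fin.sum_univ_three, h2]
    · refine isTame_affMap_of_mul (M := !![1, 0, 0; s, t, 0; 0, 0, 1])
        (by simpa [Matrix.det_fin_three] using ht) (isTame_affMap_of_dependent ?_ ?_ ?_ (h.mul _))
      · simpa [Matrix.mul_apply, Fin.sum_univ_three] using e0
      · simpa [Matrix.mul_apply, Fin.sum_univ_three] using e1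
      · ext j; simp [Matrix.mul_apply, Fin.sum_univ_three, h2]
  obtain ⟨D, hD'⟩ : ∃ D, D = A 0 0 * A 1 1 - A 0 1 * A 1 0 := ⟨_, rfl⟩
  rw [← hD'] at hD
  have hex : ∀ p : Fin 6 → ℂ, ∃ p', ∀ x y, quadFn p' x y = quadFn p
      (A 1 1 / D * x + -A 0 1 / D * y + (A 0 1 * A 1 2 - A 1 1 * A 0 2) / D)
      (-A 1 0 / D * x + A 0 0 / D * y + (A 1 0 * A 0 2 - A 0 0 * A 1 2) / D) :=
    fun p => exists_quadFn_affine p _ _ _ _ _ _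
  obtain ⟨p, hp⟩ := hex (P 0)
  obtain ⟨q, hq⟩ := hex (P 1)
  obtain ⟨b, hb⟩ := hex (P 2)
  rw [affMap_eq_mkMap]
  refine IsTame.of_affine _ _ _ (α := A 1 1 / D) (β := -A 0 1 / D)
    (γ := (A 0 1 * A 1 2 - A 1 1 * A 0 2) / D) (α' := -A 1 0 / D) (β' := A 0 0 / D)
    (γ' := (A 1 0 * A 0 2 - A 0 0 * A 1 2) / D) ?_ ?_
  · have : A 1 1 / D * (A 0 0 / D) - -A 0 1 / D * (-A 1 0 / D) = D⁻¹ := by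
      field_simp; rw [hD']; ring
    rw [this]
    exact inv_ne_zero hD
  · convert isTame_pencilMap p q b using 1
    unfold pencilMap
    congr 1 <;> ext x y z
    · rw [hp]
      congr 1
      field_simp; rw [hD']; ring
    · rw [hq]
      congr 1
      field_simp; rw [hD']; ring
    · simp [hb, h2]

theorem EscapesVertically.det_eq_zero (h : EscapesVertically A P) : A.det = 0 := by
  obtain ⟨U, x, y, z, m, hz, hx, hy, hm⟩ := h
  have hzi : Tendsto (fun n => (z n)⁻¹) U (𝓝 0) := tendsto_inv₀_cobounded.comp hz
  obtain ⟨N, hN⟩ : ∃ N : ℕ → Matrix (Fin 3) (Fin 3) ℂ, N = fun n => A + Matrix.of fun i =>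
      ![P i 0 * (x n / z n) + P i 1 * (y n / z n), P i 2 * (y n / z n),
        P i 3 * (x n / z n) + P i 4 * (y n / z n) + P i 5 * (z n)⁻¹] := ⟨_, rfl⟩
  have hNA : Tendsto N U (𝓝 A) := by
    refine tendsto_pi_nhds.mpr fun i => tendsto_pi_nhds.mpr fun j => ?_
    rw [hN]
    fin_cases j
    · simpa using ((hx.const_mul (P i 0)).add (hy.const_mul (P i 1))).const_add (A i 0)
    · simpa using (hy.const_mul (P i 2)).const_add (A i 1)
    · simpa using (((hx.const_mul (P i 3)).add (hy.const_mul (P i 4))).add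
        (hzi.const_mul (P i 5))).const_add (A i 2)
  have hdet : Tendsto (fun n => (N n).det) U (𝓝 A.det) :=
    ((Continuous.matrix_det continuous_id).tendsto A).comp hNA
  have hadj : Tendsto (fun n => (N n).adjugate) U (𝓝 A.adjugate) :=
    ((Continuous.matrix_adjugate continuous_id).tendsto A).comp hNA
  have hF : Tendsto (fun n => (z n)⁻¹ • affMap A P ![x n, y n, z n]) U (𝓝 0) := by
    simpa using hzi.smul hm
  have hvec : Tendsto (fun n => ((N n).adjugate.mulVec
      ((z n)⁻¹ • affMap A P ![x n, y n, z n])) 2) U (𝓝 0) := by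
    have := ((Continuous.matrix_mulVec continuous_fst continuous_snd).tendsto
      (A.adjugate, (0 : Fin 3 → ℂ))).comp (hadj.prodMk_nhds hF)
    simpa using tendsto_pi_nhds.mp this 2
  refine tendsto_nhds_unique hdet (hvec.congr' ?_)
  filter_upwards [hz.eventually_ne_cobounded 0] with n hn
  have : (z n)⁻¹ • affMap A P ![x n, y n, z n] = (N n).mulVec ![x n, y n, 1] := by
    ext i
    simp [affMap, quadFn, hN, Matrix.mulVec, dotProduct, Fin.sum_univ_three]
    field_simp
    ring
  rw [this, Matrix.mulVec_mulVec, Matrix.adjugate_mul]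
  simp [Matrix.smul_mulVec]

theorem exists_det_ne_zero_col {e : Fin 3 → ℂ} (he : e ≠ 0) :
    ∃ M : Matrix (Fin 3) (Fin 3) ℂ, M.det ≠ 0 ∧ ∀ i, M i 2 = e i := by
  by_cases h2 : e 2 = 0
  · by_cases h1 : e 1 = 0
    · refine ⟨!![0, 0, e 0; 1, 0, e 1; 0, 1, e 2], ?_, fun i => by fin_cases i <;> rfl⟩
      have h0 : e 0 ≠ 0 := fun h0 => he (funext fun i => by fin_cases i <;> assumption)
      simpa [Matrix.det_fin_three] using h0
    · refine ⟨!![1, 0, e 0; 0, 0, e 1; 0, 1, e 2], ?_, fun i => by fin_cases i <;> rfl⟩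
      simpa [Matrix.det_fin_three] using h1
  · refine ⟨!![1, 0, e 0; 0, 1, e 1; 0, 0, e 2], ?_, fun i => by fin_cases i <;> rfl⟩
    simpa [Matrix.det_fin_three] using h2

theorem isTame_affMap (h : EscapesVertically A P) : IsTame (affMap A P) := by
  obtain ⟨l, hl, hlA⟩ := Matrix.exists_vecMul_eq_zero_iff.mpr h.det_eq_zero
  obtain ⟨M, hM, hMl⟩ := exists_det_ne_zero_col hl
  refine isTame_affMap_of_mul (M := M.transpose) (by simpa using hM)
    (isTame_affMap_of_row ?_ (h.mul _))
  ext j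
  rw [← congrFun hlA j]
  simp [Matrix.mul_apply, Matrix.vecMul, dotProduct, hMl]

theorem exists_quadratic_form {Q : MvPolynomial (Fin 3) ℂ} (hQ : Q.totalDegree ≤ 2) :
    ∃ (e : ℂ) (a : Fin 3 → ℂ) (p : Fin 6 → ℂ), ∀ v : Fin 3 → ℂ, MvPolynomial.eval v Q =
      e * v 2 ^ 2 + (a 0 * v 0 + a 1 * v 1 + a 2) * v 2 + quadFn p (v 0) (v 1) := by
  have hmon : ∀ d ∈ Q.support, ∃ (e : ℂ) (a : Fin 3 → ℂ) (p : Fin 6 → ℂ), ∀ v : Fin 3 → ℂ,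
      Q.coeff d * ∏ i, v i ^ d i =
        e * v 2 ^ 2 + (a 0 * v 0 + a 1 * v 1 + a 2) * v 2 + quadFn p (v 0) (v 1) := by
    intro d hd
    have hdeg : d 0 + d 1 + d 2 ≤ 2 := by
      have := (MvPolynomial.le_totalDegree hd).trans hQ
      rwa [Finsupp.sum_fintype _ _ (by simp), Fin.sum_univ_three] at this
    obtain ⟨c, hc⟩ : ∃ c, c = Q.coeff d := ⟨_, rfl⟩
    obtain ⟨i, hi⟩ : ∃ i, i = d 0 := ⟨_, rfl⟩
    obtain ⟨j, hj⟩ : ∃ j, j = d 1 := ⟨_, rfl⟩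
    obtain ⟨k, hk⟩ : ∃ k, k = d 2 := ⟨_, rfl⟩
    simp only [Fin.prod_univ_three, ← hc, ← hi, ← hj, ← hk] at hdeg ⊢
    have : (i = 0 ∧ j = 0 ∧ k = 0) ∨ (i = 1 ∧ j = 0 ∧ k = 0) ∨ (i = 0 ∧ j = 1 ∧ k = 0) ∨
      (i = 0 ∧ j = 0 ∧ k = 1) ∨ (i = 2 ∧ j = 0 ∧ k = 0) ∨ (i = 0 ∧ j = 2 ∧ k = 0) ∨
      (i = 0 ∧ j = 0 ∧ k = 2) ∨ (i = 1 ∧ j = 1 ∧ k = 0) ∨ (i = 1 ∧ j = 0 ∧ k = 1) ∨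
      (i = 0 ∧ j = 1 ∧ k = 1) := by omega
    rcases this with h | h | h | h | h | h | h | h | h | h <;> obtain ⟨rfl, rfl, rfl⟩ := h
    · exact ⟨0, 0, ![0, 0, 0, 0, 0, c], fun v => by simp [quadFn]⟩
    · exact ⟨0, 0, ![0, 0, 0, c, 0, 0], fun v => by simp [quadFn]⟩
    · exact ⟨0, 0, ![0, 0, 0, 0, c, 0], fun v => by simp [quadFn]⟩
    · exact ⟨0, ![0, 0, c], 0, fun v => by simp [quadFn]⟩
    · exact ⟨0, 0, ![c, 0, 0, 0, 0, 0], fun v => by simp [quadFn]⟩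
    · exact ⟨0, 0, ![0, 0, c, 0, 0, 0], fun v => by simp [quadFn]⟩
    · exact ⟨c, 0, 0, fun v => by simp [quadFn]⟩
    · exact ⟨0, 0, ![0, c, 0, 0, 0, 0], fun v => by simp [quadFn]⟩
    · exact ⟨0, ![c, 0, 0], 0, fun v => by simp [quadFn]; ring⟩
    · exact ⟨0, ![0, c, 0], 0, fun v => by simp [quadFn]; ring⟩
  choose! e a p h using hmon
  refine ⟨∑ d ∈ Q.support, e d, ∑ d ∈ Q.support, a d, ∑ d ∈ Q.support, p d, fun v => ?_⟩
  rw [MvPolynomial.eval_eq', Finset.sum_congr rfl fun d hd => h d hd v]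
  simp only [quadFn, Finset.sum_apply, Finset.sum_mul, Finset.sum_add_distrib, add_mul]

/-- Linear coordinates in which the points of a divergent sequence escape in the direction of
the last coordinate. -/
theorem exists_escaping_direction {U : Ultrafilter ℕ} {ξ : ℕ → Fin 3 → ℂ}
    (hξ : Tendsto (fun n => ‖ξ n‖) U atTop) :
    ∃ (M : Matrix (Fin 3) (Fin 3) ℂ) (η : ℕ → Fin 3 → ℂ), M.det ≠ 0 ∧
      (∀ n, M.mulVec (η n) = ξ n) ∧ Tendsto (fun n => η n 2) U (cobounded ℂ) ∧
      Tendsto (fun n => η n 0 / η n 2) U (𝓝 0) ∧ Tendsto (fun n => η n 1 / η n 2) U (𝓝 0) := by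
  have hpos : ∀ᶠ n in (U : Filter ℕ), ‖ξ n‖ ≠ 0 := hξ.eventually_ne_atTop 0
  obtain ⟨ζ, hζ⟩ : ∃ ζ : ℕ → Fin 3 → ℂ, ζ = fun n => (‖ξ n‖ : ℂ)⁻¹ • ξ n := ⟨_, rfl⟩
  have hnorm : ∀ᶠ n in (U : Filter ℕ), ζ n ∈ Metric.sphere (0 : Fin 3 → ℂ) 1 := by
    filter_upwards [hpos] with n hn
    rw [hζ]
    simp [norm_smul, hn]
  obtain ⟨e, he, hlim⟩ := (isCompact_sphere (0 : Fin 3 → ℂ) 1).ultrafilter_le_nhds (U.map ζ)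
    (le_principal_iff.mpr hnorm)
  have hlim : Tendsto ζ U (𝓝 e) := hlim
  have he0 : e ≠ 0 := by
    rintro rfl
    simp at he
  obtain ⟨M, hM, hMe⟩ := exists_det_ne_zero_col he0
  have hu : IsUnit M.det := isUnit_iff_ne_zero.mpr hM
  have hMe' : M⁻¹.mulVec e = ![0, 0, 1] := by
    have : e = M.mulVec ![0, 0, 1] := by
      ext i
      simp [Matrix.mulVec, dotProduct, Fin.sum_univ_three, hMe]
    rw [this, Matrix.mulVec_mulVec, Matrix.nonsing_inv_mul _ hu, Matrix.one_mulVec]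
  have hη : Tendsto (fun n => M⁻¹.mulVec (ζ n)) U (𝓝 ![0, 0, 1]) := by
    rw [← hMe']
    exact ((Continuous.matrix_mulVec continuous_const continuous_id).tendsto e).comp hlim
  have hη' : ∀ i, Tendsto (fun n => M⁻¹.mulVec (ξ n) i / ‖ξ n‖) U (𝓝 (![0, 0, 1] i)) := by
    intro i
    refine (tendsto_pi_nhds.mp hη i).congr fun n => ?_
    rw [hζ, Matrix.mulVec_smul, Pi.smul_apply, smul_eq_mul]
    ring
  have hquot : ∀ i, Tendsto (fun n => M⁻¹.mulVec (ξ n) i / M⁻¹.mulVec (ξ n) 2) U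
      (𝓝 (![0, 0, 1] i / ![(0 : ℂ), 0, 1] 2)) := by
    intro i
    refine ((hη' i).div (hη' 2) (by simp)).congr' ?_
    filter_upwards [hpos] with n hn
    exact div_div_div_cancel_right₀ (by exact_mod_cast hn) _ _
  refine ⟨M, fun n => M⁻¹.mulVec (ξ n), hM, fun n => ?_, ?_, ?_, ?_⟩
  · rw [Matrix.mulVec_mulVec, Matrix.mul_nonsing_inv _ hu, Matrix.one_mulVec]
  · rw [← tendsto_norm_atTop_iff_cobounded]
    have := hξ.atTop_mul_pos (C := ‖(1 : ℂ)‖) (by simp) (hη' 2).norm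
    refine this.congr' ?_
    filter_upwards [hpos] with n hn
    rw [norm_div]
    simp
    field_simp
  · simpa using hquot 0
  · simpa using hquot 1

theorem IsDegTwoPolyMap.isTame {P : Fin 3 → MvPolynomial (Fin 3) ℂ}
    {F : (Fin 3 → ℂ) → (Fin 3 → ℂ)} (hP : IsDegTwoPolyMap P F) (hne : asymptoticSet F ≠ ∅) :
    IsTame F := by
  obtain ⟨hF, hdeg, -⟩ := hP
  obtain ⟨m, ξ, hξ, hm⟩ := Set.nonempty_iff_ne_empty.mpr hne
  obtain ⟨U, hU⟩ : ∃ U : Ultrafilter ℕ, (U : Filter ℕ) ≤ atTop := ⟨_, Ultrafilter.of_le atTop⟩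
  obtain ⟨M, η, hM, hη, hz, hx, hy⟩ := exists_escaping_direction (hξ.mono_left hU)
  have hu : IsUnit M.det := isUnit_iff_ne_zero.mpr hM
  refine .of_comp (φ := fun v => M.mulVec v) (ψ := fun v => M⁻¹.mulVec v)
    (Continuous.matrix_mulVec continuous_const continuous_id)
    (Continuous.matrix_mulVec continuous_const continuous_id)
    (fun v => by rw [Matrix.mulVec_mulVec, Matrix.nonsing_inv_mul _ hu, Matrix.one_mulVec])
    (fun v => by rw [Matrix.mulVec_mulVec, Matrix.mul_nonsing_inv _ hu, Matrix.one_mulVec]) ?_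
  choose e A p h using fun i =>
    exists_quadratic_form ((totalDegree_linSubst_le M (P i)).trans (hdeg i))
  have hFM : ∀ v i, F (M.mulVec v) i = e i * v 2 ^ 2 +
      (A i 0 * v 0 + A i 1 * v 1 + A i 2) * v 2 + quadFn (p i) (v 0) (v 1) := fun v i => by
    rw [hF, ← eval_linSubst, h]
  have hconv : Tendsto (fun n => F (M.mulVec (η n))) U (𝓝 m) := by
    simpa only [hη] using hm.mono_left hU
  have he : ∀ i, e i = 0 := by
    intro i
    have := leadingCoeff_two hz ((tendsto_pi_nhds.mp hconv i).const_sub (p i 5))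
      ((((hx.const_mul (p i 3)).add (hy.const_mul (p i 4))).const_add (A i 2)))
      ((((hx.const_mul (A i 0)).add (hy.const_mul (A i 1))).add
        ((((hx.pow 2).const_mul (p i 0)).add ((hx.mul hy).const_mul (p i 1))).add
        ((hy.pow 2).const_mul (p i 2)))).const_add (e i)) (by
      filter_upwards [hz.eventually_ne_cobounded 0] with n hn
      rw [hFM]
      unfold quadFn
      field_simp
      ring)
    simpa using this
  have hmap : (fun v => F (M.mulVec v)) = affMap (Matrix.of A) (Matrix.of p) := by
    ext v i
    rw [hFM, he]
    simp [affMap]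
    rfl
  rw [hmap]
  refine isTame_affMap ⟨U, fun n => η n 0, fun n => η n 1, fun n => η n 2, m, hz, hx, hy, ?_⟩
  rw [← hmap]
  refine hconv.congr fun n => ?_
  congr 2
  ext i
  fin_cases i <;> rfl

theorem IsUnionOfThree.exists_isIrredZeroSet {S : Set (Fin 3 → ℂ)} (h : IsUnionOfThree S)
    (hne : S ≠ ∅) : ∃ Z₁ Z₂ Z₃, (∀ Z ∈ [Z₁, Z₂, Z₃], IsIrredZeroSet Z) ∧ S = Z₁ ∪ Z₂ ∪ Z₃ := by
  obtain ⟨Z₁, Z₂, Z₃, h1, h2, h3, rfl⟩ := h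
  rcases h1 with rfl | h1 <;> rcases h2 with rfl | h2 <;> rcases h3 with rfl | h3
  · simp at hne
  · exact ⟨Z₃, Z₃, Z₃, by simp [h3], by simp⟩
  · exact ⟨Z₂, Z₂, Z₂, by simp [h2], by simp⟩
  · exact ⟨Z₂, Z₃, Z₃, by simp [h2, h3], by simp [Set.union_assoc]⟩
  · exact ⟨Z₁, Z₁, Z₁, by simp [h1], by simp⟩
  · exact ⟨Z₁, Z₃, Z₃, by simp [h1, h3], by simp [Set.union_assoc]⟩
  · exact ⟨Z₁, Z₂, Z₂, by simp [h1, h2], by simp [Set.union_assoc]⟩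
  · exact ⟨Z₁, Z₂, Z₃, by simp [h1, h2, h3], rfl⟩

end Assembly

/-- The asymptotic set of a non-proper dominant degree-2 polynomial mapping `F : ℂ³ → ℂ³`
is the union of at most three zero sets of irreducible polynomials of total degree at most 2. -/
theorem asymptoticSet_union_of_at_most_three
    (P : Fin 3 → MvPolynomial (Fin 3) ℂ) (F : (Fin 3 → ℂ) → (Fin 3 → ℂ))
    (hP : IsDegTwoPolyMap P F)
    (hdom : Dense (Set.range F))
    (hne : asymptoticSet F ≠ ∅) :
    ∃ Z₁ Z₂ Z₃ : Set (Fin 3 → ℂ),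
      (∀ Z ∈ [Z₁, Z₂, Z₃], ∃ Q : MvPolynomial (Fin 3) ℂ,
        Irreducible Q ∧ Q.totalDegree ≤ 2 ∧ Z = {x | MvPolynomial.eval x Q = 0}) ∧
      asymptoticSet F = Z₁ ∪ Z₂ ∪ Z₃ :=
  (hP.isTame hne hdom).exists_isIrredZeroSet hne
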